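/- (Theorem 3, identity part) Let g ∈ L_1(ℝ) and suppose that ∫_0^∞ |(Gg)(x)| x^{ν−1} dx < ∞ for some ν with 0 < ν < 1/2. Then for all y > 0: (1/(2πi)) ∫_{ν−i∞}^{ν+i∞} Γ(s)Γ(1−s)² (Gg)*(s) y^{−s} ds = √π ∫_{−∞}^∞ e^{y/2} K_{iτ}(y/2) · g(τ)/cosh(πτ) dτ, where (Gg)*(s) = ∫_0^∞ (Gg)(x) x^{s−1} dx is the Mellin transform of Gg. -/

import Mathlib

open Complex MeasureTheory Real Set

/-- Bessel function of the first kind, defined by its power series. -/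
noncomputable def besselJ (ν z : ℂ) : ℂ :=
  ∑' k : ℕ, ((-1 : ℂ) ^ k * (z / 2) ^ (2 * (k : ℂ) + ν)) /
    ((k.factorial : ℂ) * Complex.Gamma ((k : ℂ) + ν + 1))

/-- Modified Bessel function of the first kind, defined by its power series. -/
noncomputable def besselI (ν z : ℂ) : ℂ :=
  ∑' k : ℕ, (z / 2) ^ (2 * (k : ℂ) + ν) /
    ((k.factorial : ℂ) * Complex.Gamma ((k : ℂ) + ν + 1))

/-- The Macdonald function `K_ν(z) = π (I_{−ν}(z) − I_ν(z)) / (2 sin(πν))`. -/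
noncomputable def besselK (ν z : ℂ) : ℂ :=
  (π : ℂ) * (besselI (-ν) z - besselI ν z) / (2 * Complex.sin ((π : ℂ) * ν))

/-- The index transform `(Gg)(x) = √π ∫_{−∞}^∞ Re[J_{iτ}(√x)²] g(τ)/cosh(πτ) dτ`. -/
noncomputable def indexG (g : ℝ → ℂ) (x : ℝ) : ℂ :=
  (Real.sqrt π : ℂ) * ∫ τ : ℝ,
    ((((besselJ (Complex.I * τ) (Real.sqrt x : ℂ)) ^ 2).re : ℝ) : ℂ) * g τ /
      ((Real.cosh (π * τ) : ℝ) : ℂ)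

/-- The Mellin transform `f*(s) = ∫_0^∞ f(x) x^{s−1} dx`. -/
noncomputable def mellinT (f : ℝ → ℂ) (s : ℂ) : ℂ :=
  ∫ x in Set.Ioi (0 : ℝ), f x * (x : ℂ) ^ (s - 1)

/-- The `k`-th Taylor coefficient of the Bessel–Clifford function of index `μ`. -/
noncomputable def cliffordCoeff (μ : ℂ) (k : ℕ) : ℂ :=
  ((k.factorial : ℂ) * Complex.Gamma ((k : ℂ) + μ + 1))⁻¹

/-- The Bessel–Clifford function `∑ z ^ k / (k! Γ(k + μ + 1))`, entire in `z` and in `μ`. -/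
noncomputable def clifford (μ z : ℂ) : ℂ := ∑' k : ℕ, cliffordCoeff μ k * z ^ k

lemma summable_pow_of_forall_norm {c : ℕ → ℂ} {r : ℝ}
    (hc : Summable fun k => ‖c k‖ * r ^ k) {z : ℂ} (hz : ‖z‖ ≤ r) :
    Summable fun k => c k * z ^ k := by
  refine Summable.of_norm_bounded hc fun k => ?_
  rw [norm_mul, norm_pow]
  gcongr

lemma hasDerivAt_tsum_pow {c : ℕ → ℂ} {r : ℝ} (hc : Summable fun k => ‖c k‖ * r ^ k) {z : ℂ}
    (hz : ‖z‖ < r) :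
    HasDerivAt (fun w => ∑' k, c k * w ^ k) (deriv (fun w => ∑' k, c k * w ^ k) z) z ∧
      HasSum (fun k : ℕ => (k : ℂ) * c k * z ^ k) (z * deriv (fun w => ∑' k, c k * w ^ k) z) ∧
      HasSum (fun k : ℕ => ((k : ℂ) + 1) * c (k + 1) * z ^ k)
        (deriv (fun w => ∑' k, c k * w ^ k) z) := by
  have hd : ∀ k, DifferentiableOn ℂ (fun w : ℂ => c k * w ^ k) (Metric.ball 0 r) := by
    intro k; fun_prop
  have hb : ∀ k, ∀ w ∈ Metric.ball (0 : ℂ) r, ‖c k * w ^ k‖ ≤ ‖c k‖ * r ^ k := by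
    intro k w hw
    rw [mem_ball_zero_iff] at hw
    rw [norm_mul, norm_pow]
    gcongr
  have hmem : z ∈ Metric.ball (0 : ℂ) r := by simpa using hz
  have h1 := Complex.hasSum_deriv_of_summable_norm hc hd Metric.isOpen_ball hb hmem
  have h2 := (Complex.differentiableOn_tsum_of_summable_norm hc hd Metric.isOpen_ball hb
    ).differentiableAt (Metric.isOpen_ball.mem_nhds hmem)
  have hderiv : ∀ k : ℕ, deriv (fun w : ℂ => c k * w ^ k) z = c k * (k * z ^ (k - 1)) := by
    intro k
    simp
  simp only [hderiv] at h1
  refine ⟨h2.hasDerivAt, ?_, ?_⟩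
  · refine (h1.mul_left z).congr_fun ?_
    intro k
    rcases k with _ | k
    · simp
    · simp [pow_succ]; ring
  · have := (hasSum_nat_add_iff' 1).2 h1
    simp only [Finset.range_one, Finset.sum_singleton, Nat.cast_zero, zero_mul, mul_zero,
      sub_zero, Nat.add_sub_cancel] at this
    refine this.congr_fun ?_
    intro k
    push_cast; ring

lemma cliffordCoeff_succ (μ : ℂ) (k : ℕ) :
    ((k : ℂ) + 1) * cliffordCoeff μ (k + 1) = cliffordCoeff (μ + 1) k := by
  have hk : ((k : ℂ) + 1) ≠ 0 := by exact_mod_cast Nat.succ_ne_zero k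
  simp only [cliffordCoeff, Nat.factorial_succ]
  push_cast
  rw [show (k : ℂ) + 1 + μ + 1 = k + (μ + 1) + 1 by ring]
  field_simp

lemma cliffordCoeff_eq_mul (μ : ℂ) (k : ℕ) :
    cliffordCoeff μ k = ((k : ℂ) + μ + 1) * cliffordCoeff (μ + 1) k := by
  simp only [cliffordCoeff, mul_inv]
  rw [Complex.one_div_Gamma_eq_self_mul_one_div_Gamma_add_one,
    show (k : ℂ) + μ + 1 + 1 = k + (μ + 1) + 1 by ring]
  ring

lemma summable_norm_cliffordCoeff (μ : ℂ) (r : ℝ) :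
    Summable fun k => ‖cliffordCoeff μ k‖ * r ^ k := by
  refine summable_of_ratio_norm_eventually_le (r := 1 / 2) (by norm_num) ?_
  have h1 : ∀ᶠ n : ℕ in Filter.atTop, ‖μ‖ + 1 + 2 * |r| ≤ n :=
    tendsto_natCast_atTop_atTop.eventually_ge_atTop _
  filter_upwards [h1] with n hn
  have hn1 : (1 : ℝ) ≤ ‖(n : ℂ) + μ + 1‖ := by
    have := norm_sub_le ((n : ℂ) + μ + 1) (μ + 1)
    have h2 := norm_add_le μ 1
    rw [show (n : ℂ) + μ + 1 - (μ + 1) = n by ring, Complex.norm_natCast] at this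
    simp at h2
    have := abs_nonneg r
    have := norm_nonneg μ
    by_cases hr : 1 ≤ |r|
    · linarith
    · have h3 : ((n : ℂ) + μ + 1) = ((n + 1 : ℝ) : ℂ) + μ := by push_cast; ring
      rw [h3]
      have h4 := norm_sub_le (((n + 1 : ℝ) : ℂ) + μ) μ
      rw [add_sub_cancel_right, Complex.norm_real, Real.norm_of_nonneg (by positivity)] at h4
      linarith
  have hc : ((n : ℂ) + 1) * ((n : ℂ) + μ + 1) * cliffordCoeff μ (n + 1) = cliffordCoeff μ n := by
    rw [cliffordCoeff_eq_mul μ n, ← cliffordCoeff_succ]; ring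
  have hcn := congrArg norm hc
  rw [norm_mul, norm_mul, show ((n : ℂ) + 1) = ((n + 1 : ℕ) : ℂ) by push_cast; rfl,
    Complex.norm_natCast] at hcn
  push_cast at hcn
  simp only [norm_mul, norm_pow, Real.norm_eq_abs, abs_norm]
  rw [pow_succ, ← hcn]
  have hC := norm_nonneg (cliffordCoeff μ (n + 1))
  have hr := abs_nonneg r
  have hμ := norm_nonneg μ
  have : |r| ≤ 1 / 2 * ((n + 1) * ‖(n : ℂ) + μ + 1‖) := by nlinarith
  calc ‖cliffordCoeff μ (n + 1)‖ * (|r| ^ n * |r|)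
      ≤ ‖cliffordCoeff μ (n + 1)‖ * (|r| ^ n * (1 / 2 * ((n + 1) * ‖(n : ℂ) + μ + 1‖))) := by
        gcongr
    _ = _ := by ring

lemma hasSum_clifford (μ z : ℂ) : HasSum (fun k => cliffordCoeff μ k * z ^ k) (clifford μ z) :=
  (summable_pow_of_forall_norm (summable_norm_cliffordCoeff μ ‖z‖) le_rfl).hasSum

lemma hasDerivAt_clifford (μ z : ℂ) : HasDerivAt (clifford μ) (clifford (μ + 1) z) z := by
  obtain ⟨h1, -, h3⟩ := hasDerivAt_tsum_pow (summable_norm_cliffordCoeff μ (‖z‖ + 1))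
    (lt_add_one ‖z‖)
  simp only [cliffordCoeff_succ] at h3
  rw [h3.unique (hasSum_clifford (μ + 1) z)] at h1
  exact h1

lemma clifford_recurrence (μ z : ℂ) :
    clifford μ z = (μ + 1) * clifford (μ + 1) z + z * clifford (μ + 2) z := by
  obtain ⟨h1, h2, -⟩ := hasDerivAt_tsum_pow (summable_norm_cliffordCoeff (μ + 1) (‖z‖ + 1))
    (lt_add_one ‖z‖)
  have h4 := (hasDerivAt_clifford (μ + 1) z).unique h1
  rw [← h4, add_assoc, one_add_one_eq_two] at h2
  refine (hasSum_clifford μ z).unique ?_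
  refine (((hasSum_clifford (μ + 1) z).mul_left (μ + 1)).add h2).congr_fun ?_
  intro k
  rw [cliffordCoeff_eq_mul μ k]
  ring

lemma clifford_zero (μ : ℂ) : clifford μ 0 = (Complex.Gamma (μ + 1))⁻¹ := by
  rw [clifford, tsum_eq_single 0]
  · simp [cliffordCoeff]
  · intro k hk; simp [hk]

lemma measurable_clifford : Measurable (Function.uncurry clifford) := by
  refine measurable_of_tendsto_metrizable (f := fun n (p : ℂ × ℂ) =>
    ∑ k ∈ Finset.range n, cliffordCoeff p.1 k * p.2 ^ k) ?_ ?_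
  · intro n
    have hG : Measurable fun s : ℂ => (Complex.Gamma s)⁻¹ :=
      Complex.differentiable_one_div_Gamma.continuous.measurable
    simp only [cliffordCoeff, mul_inv]
    refine Finset.measurable_sum _ fun k _ => ?_
    refine Measurable.mul (measurable_const.mul (hG.comp ?_)) ?_ <;> fun_prop
  · rw [tendsto_pi_nhds]
    intro p
    exact (hasSum_clifford p.1 p.2).tendsto_sum_nat

/-- Wronskian relation between the two Bessel–Clifford solutions of index `μ` and `-μ`. -/
lemma clifford_wronskian (μ z : ℂ) :
    z * clifford (1 - μ) z * clifford μ z - z * clifford (-μ) z * clifford (μ + 1) z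
      - μ * clifford μ z * clifford (-μ) z = -Complex.sin (π * μ) / π := by
  set V : ℂ → ℂ := fun z => z * clifford (1 - μ) z * clifford μ z
    - z * clifford (-μ) z * clifford (μ + 1) z - μ * clifford μ z * clifford (-μ) z with hV
  have hd : ∀ z, HasDerivAt V 0 z := by
    intro z
    have a1 := hasDerivAt_clifford (1 - μ) z
    have a2 := hasDerivAt_clifford μ z
    have a3 := hasDerivAt_clifford (-μ) z
    have a4 := hasDerivAt_clifford (μ + 1) z
    have hz := hasDerivAt_id z
    refine ((((hz.mul a1).mul a2).sub ((hz.mul a3).mul a4)).sub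
      ((a2.const_mul μ).mul a3)).congr_deriv ?_
    have r1 := clifford_recurrence (-μ) z
    have r2 := clifford_recurrence μ z
    rw [show (1 - μ + 1) = -μ + 2 by ring, show (1 - μ) = -μ + 1 by ring,
      show μ + 1 + 1 = μ + 2 by ring]
    simp only [id, one_mul, Pi.mul_apply]
    linear_combination (-clifford μ z) * r1 + clifford (-μ) z * r2
  have hc : V z = V 0 :=
    is_const_of_deriv_eq_zero (fun z => (hd z).differentiableAt) (fun z => (hd z).deriv) z 0
  change V z = _
  rw [hc, hV]
  simp only [clifford_zero, zero_mul, zero_sub, sub_zero]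
  rw [← Complex.one_div_Gamma_eq_self_mul_one_div_Gamma_add_one μ, show -μ + 1 = 1 - μ by ring,
    ← mul_inv, Complex.Gamma_mul_Gamma_one_sub, inv_div, neg_div]

lemma half_sq_mul_le_exp_add {m z : ℝ} (hm : 0 ≤ m) (hm1 : m ≤ 1) (hz : m ≤ z) (u : ℝ) :
    m * u ^ 2 / 2 ≤ Real.exp u + z * Real.exp (-u) := by
  have h1 := Real.quadratic_le_exp_of_nonneg (abs_nonneg u)
  rw [sq_abs] at h1
  have h2 : Real.exp |u| ≤ Real.exp u + Real.exp (-u) := by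
    rcases abs_cases u with ⟨h, -⟩ | ⟨h, -⟩ <;> rw [h]
    · linarith [Real.exp_pos (-u)]
    · linarith [Real.exp_pos u]
  have h3 := Real.exp_pos u
  have h4 := Real.exp_pos (-u)
  have h5 := abs_nonneg u
  calc m * u ^ 2 / 2 ≤ m * (Real.exp u + Real.exp (-u)) := by nlinarith
    _ ≤ _ := by nlinarith

/-- The integrand of `macdonaldInt`. -/
noncomputable def macdonaldIntegrand (l : ℂ) (z u : ℝ) : ℂ :=
  Complex.exp (l * u) * (Real.exp (-(Real.exp u + z * Real.exp (-u))) : ℝ)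

/-- The Macdonald-type integral `∫ w ^ (l - 1) exp (-w - z / w) dw` over `w > 0`, written in the
variable `u = log w`. -/
noncomputable def macdonaldInt (l : ℂ) (z : ℝ) : ℂ := ∫ u : ℝ, macdonaldIntegrand l z u

lemma norm_macdonaldIntegrand (l : ℂ) (z u : ℝ) : ‖macdonaldIntegrand l z u‖ =
    Real.exp (l.re * u) * Real.exp (-(Real.exp u + z * Real.exp (-u))) := by
  rw [macdonaldIntegrand, norm_mul, Complex.norm_exp, Complex.norm_real, Real.norm_eq_abs,
    Real.abs_exp]
  simp

lemma continuous_macdonaldIntegrand (l : ℂ) (z : ℝ) : Continuous (macdonaldIntegrand l z) := by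
  unfold macdonaldIntegrand
  fun_prop

lemma integrable_macdonaldIntegrand (l : ℂ) {z : ℝ} (hz : 0 < z) :
    Integrable (macdonaldIntegrand l z) := by
  set m := min 1 z
  have hm : 0 < m := lt_min one_pos hz
  have h := integrable_cexp_quadratic (b := ((m / 2 : ℝ) : ℂ)) (by simpa using hm) l 0
  refine h.norm.mono' (continuous_macdonaldIntegrand l z).aestronglyMeasurable ?_
  refine Filter.Eventually.of_forall fun u => ?_
  rw [norm_macdonaldIntegrand, ← Real.exp_add, Complex.norm_exp]
  refine Real.exp_le_exp.2 ?_
  have := half_sq_mul_le_exp_add hm.le (min_le_left 1 z) (min_le_right 1 z) u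
  have h2 : (-((m / 2 : ℝ) : ℂ) * (u : ℂ) ^ 2 + l * u + 0).re = -(m / 2) * u ^ 2 + l.re * u := by
    rw [add_zero, Complex.add_re, ← Complex.ofReal_pow, ← Complex.ofReal_neg,
      ← Complex.ofReal_mul, Complex.ofReal_re, Complex.re_mul_ofReal]
  rw [h2]
  linarith

lemma cexp_mul_macdonaldIntegrand (l : ℂ) (z u : ℝ) (n : ℤ) :
    Complex.exp (n * u) * macdonaldIntegrand l z u = macdonaldIntegrand (l + n) z u := by
  rw [macdonaldIntegrand, macdonaldIntegrand, ← mul_assoc, ← Complex.exp_add]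
  ring_nf

lemma hasDerivAt_macdonaldInt (l : ℂ) {z : ℝ} (hz : 0 < z) :
    HasDerivAt (macdonaldInt l) (-macdonaldInt (l - 1) z) z := by
  have key := hasDerivAt_integral_of_dominated_loc_of_deriv_le (μ := volume) (x₀ := z)
    (s := Ioi (z / 2)) (F := fun z u => macdonaldIntegrand l z u)
    (F' := fun z u => -macdonaldIntegrand (l - 1) z u)
    (bound := fun u => ‖macdonaldIntegrand (l - 1) (z / 2) u‖)
    (Ioi_mem_nhds (by linarith))
    (Filter.Eventually.of_forall fun z => (continuous_macdonaldIntegrand l z).aestronglyMeasurable)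
    (integrable_macdonaldIntegrand l hz)
    (continuous_macdonaldIntegrand (l - 1) z).neg.aestronglyMeasurable
    (Filter.Eventually.of_forall fun u x hx => ?_)
    (integrable_macdonaldIntegrand (l - 1) (half_pos hz)).norm
    (Filter.Eventually.of_forall fun u x _ => ?_)
  · have h := key.2
    rw [integral_neg] at h
    exact h
  · rw [norm_neg, norm_macdonaldIntegrand, norm_macdonaldIntegrand]
    gcongr
    exact (mem_Ioi.1 hx).le
  · have h1 : HasDerivAt (fun x : ℝ => Real.exp (-(Real.exp u + x * Real.exp (-u))))
        (Real.exp (-(Real.exp u + x * Real.exp (-u))) * (-(1 * Real.exp (-u)))) x :=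
      ((((hasDerivAt_id x).mul_const _).const_add _).neg).exp
    refine ((h1.ofReal_comp).const_mul (Complex.exp (l * u))).congr_deriv ?_
    have h2 := cexp_mul_macdonaldIntegrand l x u (-1)
    rw [show l + ((-1 : ℤ) : ℂ) = l - 1 by push_cast; ring] at h2
    rw [← h2, macdonaldIntegrand]
    push_cast
    ring_nf

lemma macdonaldInt_recurrence (l : ℂ) {z : ℝ} (hz : 0 < z) :
    macdonaldInt (l + 1) z = l * macdonaldInt l z + z * macdonaldInt (l - 1) z := by
  have hd : ∀ u, HasDerivAt (macdonaldIntegrand l z) (l * macdonaldIntegrand l z u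
      + z * macdonaldIntegrand (l - 1) z u - macdonaldIntegrand (l + 1) z u) u := by
    intro u
    have h1 : HasDerivAt (fun u : ℝ => Real.exp (-(Real.exp u + z * Real.exp (-u))))
        (Real.exp (-(Real.exp u + z * Real.exp (-u))) *
          (-(Real.exp u + z * (Real.exp (-u) * (-1))))) u :=
      (((Real.hasDerivAt_exp u).add (((hasDerivAt_id u).neg.exp).const_mul z)).neg).exp
    have h2 : HasDerivAt (fun u : ℝ => Complex.exp (l * u)) (Complex.exp (l * u) * (l * 1)) u :=
      ((Complex.ofRealCLM.hasDerivAt (x := u)).const_mul l).cexp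
    refine (h2.mul h1.ofReal_comp).congr_deriv ?_
    have e1 := cexp_mul_macdonaldIntegrand l z u (-1)
    have e2 := cexp_mul_macdonaldIntegrand l z u 1
    rw [show l + ((-1 : ℤ) : ℂ) = l - 1 by push_cast; ring] at e1
    rw [show l + ((1 : ℤ) : ℂ) = l + 1 by push_cast; ring] at e2
    rw [← e1, ← e2, macdonaldIntegrand]
    push_cast
    ring_nf
  have i1 := (integrable_macdonaldIntegrand l hz).const_mul l
  have i2 := (integrable_macdonaldIntegrand (l - 1) hz).const_mul (z : ℂ)
  have i3 := integrable_macdonaldIntegrand (l + 1) hz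
  have i12 : Integrable fun u =>
      l * macdonaldIntegrand l z u + z * macdonaldIntegrand (l - 1) z u := i1.add i2
  have h := integral_eq_zero_of_hasDerivAt_of_integrable hd (i12.sub i3)
    (integrable_macdonaldIntegrand l hz)
  rw [integral_sub i12 i3, integral_add i1 i2, integral_const_mul, integral_const_mul] at h
  exact (sub_eq_zero.1 h).symm

lemma macdonaldInt_neg (l : ℂ) {z : ℝ} (hz : 0 < z) :
    macdonaldInt (-l) z = (z : ℂ) ^ (-l) * macdonaldInt l z := by
  rw [macdonaldInt, ← integral_sub_left_eq_self _ volume (Real.log z), macdonaldInt,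
    ← integral_const_mul]
  congr 1 with u
  have h1 : Real.exp (Real.log z - u) = z * Real.exp (-u) := by
    rw [sub_eq_add_neg, Real.exp_add, Real.exp_log hz]
  have h2 : z * Real.exp (-(Real.log z - u)) = Real.exp u := by
    rw [neg_sub, Real.exp_sub, Real.exp_log hz]; field_simp
  rw [macdonaldIntegrand, macdonaldIntegrand, h1, h2,
    Complex.cpow_def_of_ne_zero (by exact_mod_cast hz.ne'), ← Complex.ofReal_log hz.le,
    ← mul_assoc, ← Complex.exp_add]
  push_cast
  ring_nf

lemma integrable_and_integral_macdonaldIntegrand_zero {l : ℂ} (hl : 0 < l.re) :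
    Integrable (macdonaldIntegrand l 0) ∧ macdonaldInt l 0 = Complex.Gamma l := by
  have hd : ∀ x ∈ univ, HasDerivWithinAt Real.exp (Real.exp x) univ x :=
    fun x _ => (Real.hasDerivAt_exp x).hasDerivWithinAt
  have him : Real.exp '' univ = Ioi 0 := by rw [image_univ, Real.range_exp]
  have hfun : (fun u : ℝ => |Real.exp u| • ((Real.exp (-Real.exp u) : ℝ) *
      ((Real.exp u : ℝ) : ℂ) ^ (l - 1) : ℂ)) = macdonaldIntegrand l 0 := by
    ext u
    rw [macdonaldIntegrand, Real.abs_exp, Complex.real_smul,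
      Complex.cpow_def_of_ne_zero (by exact_mod_cast (Real.exp_pos u).ne'),
      ← Complex.ofReal_log (Real.exp_pos u).le, Real.log_exp]
    rw [show l * u = u + u * (l - 1) by ring, Complex.exp_add]
    push_cast
    simp
    ring
  have hi := Complex.GammaIntegral_convergent hl
  rw [← him, integrableOn_image_iff_integrableOn_abs_deriv_smul MeasurableSet.univ hd
    Real.exp_injective.injOn, integrableOn_univ, hfun] at hi
  refine ⟨hi, ?_⟩
  rw [Complex.Gamma_eq_integral hl, Complex.GammaIntegral, ← him,
    integral_image_eq_integral_abs_deriv_smul MeasurableSet.univ hd Real.exp_injective.injOn,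
    setIntegral_univ, hfun, macdonaldInt]

lemma tendsto_macdonaldInt_zero {l : ℂ} (hl : 0 < l.re) :
    Filter.Tendsto (macdonaldInt l) (nhdsWithin 0 (Ioi 0)) (nhds (Complex.Gamma l)) := by
  obtain ⟨hi, he⟩ := integrable_and_integral_macdonaldIntegrand_zero hl
  rw [← he]
  refine tendsto_integral_filter_of_dominated_convergence
    (fun u => ‖macdonaldIntegrand l 0 u‖) ?_ ?_ hi.norm ?_
  · exact Filter.Eventually.of_forall fun z =>
      (continuous_macdonaldIntegrand l z).aestronglyMeasurable
  · filter_upwards [self_mem_nhdsWithin] with z hz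
    refine Filter.Eventually.of_forall fun u => ?_
    rw [norm_macdonaldIntegrand, norm_macdonaldIntegrand]
    gcongr
    exact (mem_Ioi.1 hz).le
  · refine Filter.Eventually.of_forall fun u => ?_
    have : Continuous fun z => macdonaldIntegrand l z u := by
      unfold macdonaldIntegrand; fun_prop
    exact (this.tendsto 0).mono_left nhdsWithin_le_nhds

lemma macdonaldInt_clifford {μ : ℂ} (hμ : -1 < μ.re) {z : ℝ} (hz : 0 < z) :
    z * macdonaldInt μ z * clifford (μ + 1) z + macdonaldInt (μ + 1) z * clifford μ z = 1 := by
  set Ω : ℝ → ℂ := fun z =>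
    z * macdonaldInt μ z * clifford (μ + 1) z + macdonaldInt (μ + 1) z * clifford μ z with hΩ
  have hd : ∀ z ∈ Ioi (0 : ℝ), HasDerivAt Ω 0 z := by
    intro z hz
    have g1 := hasDerivAt_macdonaldInt μ hz
    have g2 := hasDerivAt_macdonaldInt (μ + 1) hz
    have a1 := (hasDerivAt_clifford μ z).comp_ofReal
    have a2 := (hasDerivAt_clifford (μ + 1) z).comp_ofReal
    have hid := Complex.ofRealCLM.hasDerivAt (x := z)
    refine (((hid.mul g1).mul a2).add (g2.mul a1)).congr_deriv ?_
    have r1 := clifford_recurrence μ z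
    have r2 := macdonaldInt_recurrence μ hz
    rw [show μ + 1 + 1 = μ + 2 by ring, show μ + 1 - 1 = μ by ring]
    simp only [Complex.ofRealCLM_apply, Pi.mul_apply, Complex.ofReal_one]
    linear_combination (-macdonaldInt μ z) * r1 + clifford (μ + 1) z * r2
  have hlim : Filter.Tendsto Ω (nhdsWithin 0 (Ioi 0)) (nhds 1) := by
    have t1 := tendsto_macdonaldInt_zero (l := μ + 1) (by simp; linarith)
    have t2 := tendsto_macdonaldInt_zero (l := μ + 2) (by simp; linarith)
    have hc : ∀ l, Filter.Tendsto (fun z : ℝ => clifford l z) (nhdsWithin 0 (Ioi 0))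
        (nhds (clifford l 0)) := by
      intro l
      have : Continuous fun z : ℝ => clifford l z :=
        (continuous_iff_continuousAt.2 fun w => (hasDerivAt_clifford l w).continuousAt).comp
          Complex.continuous_ofReal
      simpa using (this.tendsto 0).mono_left (nhdsWithin_le_nhds (s := Ioi 0))
    have hne : μ + 1 ≠ 0 := fun h => by
      have := congrArg Complex.re h; simp at this; linarith
    have hG : Complex.Gamma (μ + 2) = (μ + 1) * Complex.Gamma (μ + 1) := by
      rw [← Complex.Gamma_add_one _ hne]; ring_nf
    have t3 := ((t2.sub (t1.const_mul (μ + 1))).mul (hc (μ + 1))).add (t1.mul (hc μ))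
    rw [hG, sub_self, zero_mul, zero_add, clifford_zero, mul_inv_cancel₀
      (Complex.Gamma_ne_zero_of_re_pos (by simp; linarith))] at t3
    refine t3.congr' ?_
    filter_upwards [self_mem_nhdsWithin] with x hx
    have := macdonaldInt_recurrence (μ + 1) hx
    rw [show μ + 1 + 1 = μ + 2 by ring, show μ + 1 - 1 = μ by ring] at this
    rw [hΩ]
    simp only [this]
    ring
  obtain ⟨a, ha⟩ := IsOpen.exists_is_const_of_deriv_eq_zero isOpen_Ioi isPreconnected_Ioi
    (fun z hz => (hd z hz).differentiableAt.differentiableWithinAt) (fun z hz => (hd z hz).deriv)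
  change Ω z = 1
  rw [ha z hz]
  refine tendsto_nhds_unique (tendsto_const_nhds.congr' ?_) hlim
  filter_upwards [self_mem_nhdsWithin] with x hx using (ha x hx).symm

/-- The connection formula between the Macdonald integral and the Bessel–Clifford functions. -/
lemma macdonaldInt_eq {μ : ℂ} (hμ : |μ.re| < 1) (hs : Complex.sin (π * μ) ≠ 0) {z : ℝ}
    (hz : 0 < z) :
    macdonaldInt μ z = π / Complex.sin (π * μ) *
      (clifford (-μ) z - (z : ℂ) ^ μ * clifford μ z) := by
  have hz0 : (z : ℂ) ≠ 0 := by exact_mod_cast hz.ne'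
  have hπ : (π : ℂ) ≠ 0 := by exact_mod_cast Real.pi_ne_zero
  have h1 := macdonaldInt_clifford (μ := μ) (abs_lt.1 hμ).1 hz
  have h2 := macdonaldInt_clifford (μ := -μ) (by simpa using (abs_lt.1 hμ).2) hz
  have h3 := clifford_wronskian μ z
  have h4 := macdonaldInt_recurrence μ hz
  have h5 := macdonaldInt_neg μ hz
  have h6 := macdonaldInt_neg (μ - 1) hz
  rw [show -(μ - 1) = -μ + 1 by ring, Complex.cpow_add _ _ hz0, Complex.cpow_one] at h6
  have h7 : (z : ℂ) ^ μ * (z : ℂ) ^ (-μ) = 1 := by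
    rw [← Complex.cpow_add _ _ hz0, add_neg_cancel, Complex.cpow_zero]
  rw [h5, h6, show -μ + 1 = 1 - μ by ring] at h2
  have h3' : macdonaldInt μ z * (Complex.sin (π * μ) / π) =
      clifford (-μ) z - (z : ℂ) ^ μ * clifford μ z := by
    have h8 : z * macdonaldInt μ z * clifford (1 - μ) z
        + z * macdonaldInt (μ - 1) z * clifford (-μ) z = (z : ℂ) ^ μ := by
      linear_combination (z : ℂ) ^ μ * h2 - (z * macdonaldInt μ z * clifford (1 - μ) z
        + z * macdonaldInt (μ - 1) z * clifford (-μ) z) * h7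
    linear_combination macdonaldInt μ z * h3 + clifford (-μ) z * h1 - clifford μ z * h8
      - clifford (-μ) z * clifford μ z * h4
  rw [← h3']
  field_simp

lemma cpow_two_mul_natCast_add {w : ℂ} (hw : w ≠ 0) (ν : ℂ) (k : ℕ) :
    w ^ (2 * (k : ℂ) + ν) = w ^ ν * (w ^ 2) ^ k := by
  rw [Complex.cpow_add _ _ hw, show (2 * (k : ℂ)) = ((2 * k : ℕ) : ℂ) by push_cast; rfl,
    Complex.cpow_natCast, pow_mul, mul_comm]

lemma besselI_eq_clifford (ν : ℂ) {z : ℂ} (hz : z ≠ 0) :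
    besselI ν z = (z / 2) ^ ν * clifford ν ((z / 2) ^ 2) := by
  rw [besselI, clifford, ← tsum_mul_left]
  congr 1 with k
  rw [cpow_two_mul_natCast_add (div_ne_zero hz two_ne_zero), cliffordCoeff]
  ring

lemma besselJ_eq_clifford (ν : ℂ) {z : ℂ} (hz : z ≠ 0) :
    besselJ ν z = (z / 2) ^ ν * clifford ν (-(z / 2) ^ 2) := by
  rw [besselJ, clifford, ← tsum_mul_left]
  congr 1 with k
  rw [cpow_two_mul_natCast_add (div_ne_zero hz two_ne_zero), cliffordCoeff, neg_pow ((z / 2) ^ 2)]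
  ring

lemma cpow_sq_of_pos {a : ℝ} (ha : 0 < a) (ν : ℂ) :
    ((a : ℂ) ^ 2) ^ ν = (a : ℂ) ^ ν * (a : ℂ) ^ ν := by
  rw [sq, Complex.mul_cpow_ofReal_nonneg ha.le ha.le]

lemma besselK_eq_macdonaldInt {μ : ℂ} (hμ : |μ.re| < 1) (hs : Complex.sin (π * μ) ≠ 0) {x : ℝ}
    (hx : 0 < x) :
    besselK μ x = ((x / 2 : ℝ) : ℂ) ^ (-μ) / 2 * macdonaldInt μ ((x / 2) ^ 2) := by
  have hx0 : (x : ℂ) ≠ 0 := by exact_mod_cast hx.ne'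
  have hx2 : 0 < x / 2 := half_pos hx
  have hc : (x : ℂ) / 2 = ((x / 2 : ℝ) : ℂ) := by push_cast; rfl
  have h7 : ((x / 2 : ℝ) : ℂ) ^ (-μ) * ((x / 2 : ℝ) : ℂ) ^ μ = 1 := by
    rw [← Complex.cpow_add _ _ (by exact_mod_cast hx2.ne'), neg_add_cancel, Complex.cpow_zero]
  rw [macdonaldInt_eq hμ hs (by positivity), besselK, besselI_eq_clifford _ hx0,
    besselI_eq_clifford _ hx0, hc, Complex.ofReal_pow, cpow_sq_of_pos hx2]
  field_simp
  linear_combination (((x / 2 : ℝ) : ℂ) ^ μ * clifford μ (((x / 2 : ℝ) : ℂ) ^ 2)) * h7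

lemma sin_pi_mul_I_mul_ne_zero {τ : ℝ} (hτ : τ ≠ 0) :
    Complex.sin (π * (Complex.I * τ)) ≠ 0 := by
  rw [show (π : ℂ) * (Complex.I * τ) = ((π * τ : ℝ) : ℂ) * Complex.I by push_cast; ring,
    Complex.sin_mul_I, ← Complex.ofReal_sinh]
  refine mul_ne_zero ?_ Complex.I_ne_zero
  exact_mod_cast Real.sinh_ne_zero.2 (mul_ne_zero Real.pi_ne_zero hτ)

lemma integrable_exp_neg_mul_cosh {x : ℝ} (hx : 0 < x) :
    Integrable fun v : ℝ => Real.exp (-(x * Real.cosh v)) := by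
  have h := integrable_exp_neg_mul_sq (b := x / 4) (by positivity)
  refine h.mono' (by fun_prop) (Filter.Eventually.of_forall fun v => ?_)
  rw [Real.norm_eq_abs, Real.abs_exp]
  refine Real.exp_le_exp.2 ?_
  have h1 := half_sq_mul_le_exp_add zero_le_one le_rfl le_rfl v
  rw [Real.cosh_eq]
  nlinarith

lemma macdonaldInt_sq (μ : ℂ) {a : ℝ} (ha : 0 < a) :
    macdonaldInt μ (a ^ 2) = (a : ℂ) ^ μ *
      ∫ v : ℝ, Complex.exp (μ * v) * (Real.exp (-(2 * a * Real.cosh v)) : ℝ) := by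
  rw [macdonaldInt, ← integral_add_right_eq_self _ (Real.log a), ← integral_const_mul]
  congr 1 with v
  have h1 : Real.exp (v + Real.log a) = a * Real.exp v := by
    rw [Real.exp_add, Real.exp_log ha, mul_comm]
  have h2 : a ^ 2 * Real.exp (-(v + Real.log a)) = a * Real.exp (-v) := by
    rw [neg_add, Real.exp_add, Real.exp_neg (Real.log a), Real.exp_log ha]; field_simp
  rw [macdonaldIntegrand, h1, h2, Complex.cpow_def_of_ne_zero (by exact_mod_cast ha.ne'),
    ← Complex.ofReal_log ha.le, ← mul_assoc, ← Complex.exp_add, Real.cosh_eq]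
  push_cast
  ring_nf

lemma besselK_I_mul_eq_integral {τ : ℝ} (hτ : τ ≠ 0) {x : ℝ} (hx : 0 < x) :
    besselK (Complex.I * τ) x =
      ∫ v in Ioi (0 : ℝ), ((Real.cos (τ * v) * Real.exp (-(x * Real.cosh v)) : ℝ) : ℂ) := by
  have hx2 : 0 < x / 2 := half_pos hx
  rw [besselK_eq_macdonaldInt (by simp) (sin_pi_mul_I_mul_ne_zero hτ) hx, macdonaldInt_sq _ hx2]
  set f : ℝ → ℂ := fun v => Complex.exp (Complex.I * τ * v) *
    (Real.exp (-(2 * (x / 2) * Real.cosh v)) : ℝ) with hf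
  have hfi : Integrable f := by
    refine (integrable_exp_neg_mul_cosh hx).mono' (by fun_prop)
      (Filter.Eventually.of_forall fun v => ?_)
    rw [hf, norm_mul, Complex.norm_exp, Complex.norm_real, Real.norm_eq_abs, Real.abs_exp,
      mul_div_cancel₀ _ (two_ne_zero)]
    simp
  have h7 : ((x / 2 : ℝ) : ℂ) ^ (-(Complex.I * τ)) * ((x / 2 : ℝ) : ℂ) ^ (Complex.I * τ) = 1 := by
    rw [← Complex.cpow_add _ _ (by exact_mod_cast hx2.ne'), neg_add_cancel, Complex.cpow_zero]
  have hsplit : ∫ v, f v = ∫ v in Ioi (0 : ℝ), (f v + f (-v)) := by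
    rw [integral_add hfi.integrableOn hfi.comp_neg.integrableOn, integral_comp_neg_Ioi, neg_zero,
      add_comm, intervalIntegral.integral_Iic_add_Ioi hfi.integrableOn hfi.integrableOn]
  rw [hsplit, show ∀ a b c : ℂ, a / 2 * (b * c) = a * b * (c / 2) by intros; ring, h7, one_mul,
    ← integral_div]
  congr 1 with v
  simp only [hf, Real.cosh_neg, mul_div_cancel₀ x (two_ne_zero' ℝ)]
  rw [Complex.ofReal_mul, Complex.ofReal_cos, Complex.cos]
  push_cast
  ring_nf

lemma norm_inv_Gamma_sq_le (τ : ℝ) :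
    ‖(Complex.Gamma (Complex.I * τ + 1))⁻¹‖ ^ 2 ≤ Real.cosh (π * τ) := by
  rcases eq_or_ne τ 0 with rfl | hτ
  · simp
  have hI : Complex.I * (τ : ℂ) ≠ 0 := mul_ne_zero Complex.I_ne_zero (by exact_mod_cast hτ)
  have hconj : Complex.Gamma (1 - Complex.I * τ) =
      (starRingEnd ℂ) (Complex.Gamma (Complex.I * τ + 1)) := by
    rw [← Complex.Gamma_conj]
    congr 1
    simp [sub_eq_add_neg, add_comm]
  have h1 := Complex.Gamma_mul_Gamma_one_sub (Complex.I * τ)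
  rw [hconj] at h1
  have h2 : Complex.Gamma (Complex.I * τ + 1) *
      (starRingEnd ℂ) (Complex.Gamma (Complex.I * τ + 1)) =
        ((π * τ / Real.sinh (π * τ) : ℝ) : ℂ) := by
    rw [Complex.Gamma_add_one _ hI] at h1 ⊢
    rw [mul_assoc, h1, show (π : ℂ) * (Complex.I * τ) = ((π * τ : ℝ) : ℂ) * Complex.I by
      push_cast; ring, Complex.sin_mul_I]
    push_cast
    rw [mul_div_assoc', mul_assoc, mul_comm Complex.I, mul_div_mul_right _ _ Complex.I_ne_zero,
      mul_comm]
  rw [Complex.mul_conj] at h2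
  have h3 : ‖Complex.Gamma (Complex.I * τ + 1)‖ ^ 2 = π * τ / Real.sinh (π * τ) := by
    rw [← Complex.normSq_eq_norm_sq]
    exact_mod_cast h2
  rw [norm_inv, inv_pow, h3, inv_div]
  generalize hx : π * τ = x
  have hx0 : x ≠ 0 := hx ▸ mul_ne_zero Real.pi_ne_zero hτ
  have key : ∀ y : ℝ, 0 < y → Real.sinh y ≤ y * Real.cosh y := by
    intro y hy
    have hd : ∀ z : ℝ, HasDerivAt (fun z => z * Real.cosh z - Real.sinh z) (z * Real.sinh z) z := by
      intro z
      refine (((hasDerivAt_id z).mul (Real.hasDerivAt_cosh z)).sub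
        (Real.hasDerivAt_sinh z)).congr_deriv ?_
      simp
    have hm : MonotoneOn (fun z => z * Real.cosh z - Real.sinh z) (Ici (0 : ℝ)) := by
      refine monotoneOn_of_deriv_nonneg (convex_Ici 0)
        (fun z _ => (hd z).continuousAt.continuousWithinAt)
        (fun z _ => (hd z).differentiableAt.differentiableWithinAt) fun z hz => ?_
      rw [interior_Ici] at hz
      rw [(hd z).deriv]
      exact mul_nonneg (le_of_lt hz) (Real.sinh_nonneg_iff.2 (le_of_lt hz))
    have := hm (mem_Ici.2 le_rfl) (mem_Ici.2 hy.le) hy.le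
    simp at this
    linarith
  rcases lt_or_gt_of_ne hx0 with h | h
  · have := key (-x) (by linarith)
    rw [Real.sinh_neg, Real.cosh_neg] at this
    rw [div_le_iff_of_neg h]
    linarith
  · rw [div_le_iff₀ h]
    linarith [key x h]

lemma norm_cliffordCoeff_I_mul_le (τ : ℝ) (k : ℕ) :
    ‖cliffordCoeff (Complex.I * τ) k‖ ≤ √(Real.cosh (π * τ)) / (k.factorial : ℝ) ^ 2 := by
  have hG : ∀ k : ℕ, ‖(Complex.Gamma (k + Complex.I * τ + 1))⁻¹‖ ≤
      √(Real.cosh (π * τ)) / (k.factorial : ℝ) := by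
    intro k
    induction k with
    | zero =>
      simp only [Nat.cast_zero, zero_add, Nat.factorial_zero, Nat.cast_one, div_one]
      exact Real.le_sqrt_of_sq_le (norm_inv_Gamma_sq_le τ)
    | succ k ih =>
      have hn : ((k : ℝ) + 1) ≤ ‖(k : ℂ) + Complex.I * τ + 1‖ := by
        refine le_trans (le_of_eq ?_) (Complex.re_le_norm _)
        simp
      rw [Complex.one_div_Gamma_eq_self_mul_one_div_Gamma_add_one, norm_mul] at ih
      rw [le_div_iff₀ (by positivity)] at ih ⊢
      rw [Nat.factorial_succ]
      push_cast
      rw [show (k : ℂ) + 1 + Complex.I * τ + 1 = k + Complex.I * τ + 1 + 1 by ring]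
      refine le_trans ?_ ih
      rw [mul_comm ‖(k : ℂ) + Complex.I * τ + 1‖, mul_assoc]
      gcongr
  rw [cliffordCoeff, mul_inv, norm_mul, norm_inv, Complex.norm_natCast, sq, ← div_div,
    div_eq_inv_mul (_ / _)]
  gcongr
  exact hG k

lemma norm_clifford_I_mul_le (τ : ℝ) {a b : ℝ} (ha : 0 ≤ a) (hb : 0 ≤ b) {z : ℂ}
    (hz : ‖z‖ ≤ a * b) :
    ‖clifford (Complex.I * τ) z‖ ≤ √(Real.cosh (π * τ)) * (Real.exp a * Real.exp b) := by
  have h1 : Summable fun k : ℕ => a ^ k / k.factorial := Real.summable_pow_div_factorial a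
  have h2 : ∀ k : ℕ, ‖cliffordCoeff (Complex.I * τ) k * z ^ k‖ ≤
      √(Real.cosh (π * τ)) * (a ^ k / k.factorial * Real.exp b) := by
    intro k
    rw [norm_mul, norm_pow]
    calc _ ≤ √(Real.cosh (π * τ)) / (k.factorial : ℝ) ^ 2 * (a * b) ^ k := by
          gcongr
          exact norm_cliffordCoeff_I_mul_le τ k
      _ = √(Real.cosh (π * τ)) * (a ^ k / k.factorial * (b ^ k / k.factorial)) := by
          rw [mul_pow]; field_simp
      _ ≤ _ := by
          gcongr
          exact Real.pow_div_factorial_le_exp b hb k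
  refine tsum_of_norm_bounded ?_ h2
  refine (HasSum.mul_right _ ?_).mul_left _
  have := NormedSpace.expSeries_div_hasSum_exp (𝔸 := ℝ) a
  rwa [← Real.exp_eq_exp_ℝ] at this

/-- The Euler operator `X d/dX` on formal power series. -/
noncomputable def eulerDerivation : Derivation ℂ (PowerSeries ℂ) (PowerSeries ℂ) :=
  (PowerSeries.X : PowerSeries ℂ) • PowerSeries.derivative ℂ

lemma coeff_eulerDerivation (f : PowerSeries ℂ) (n : ℕ) :
    PowerSeries.coeff n (eulerDerivation f) = n * PowerSeries.coeff n f := by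
  rw [eulerDerivation, Derivation.smul_apply, smul_eq_mul]
  rcases n with _ | n
  · simp
  · rw [PowerSeries.coeff_succ_X_mul, PowerSeries.coeff_derivative]
    push_cast; ring

lemma coeff_clifford_sq_succ (μ : ℂ) (n : ℕ) :
    ((n : ℂ) + 1) * (n + 2 * μ + 1) * (n + μ + 1) *
        PowerSeries.coeff (n + 1) (PowerSeries.mk (cliffordCoeff μ) ^ 2) =
      2 * (2 * n + 2 * μ + 1) * PowerSeries.coeff n (PowerSeries.mk (cliffordCoeff μ) ^ 2) := by
  set W : PowerSeries ℂ := PowerSeries.mk (cliffordCoeff μ) with hW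
  set θ := eulerDerivation
  set M := θ W with hM
  have hθM : θ M = PowerSeries.X * W - μ • M := by
    ext n
    rw [hM, map_sub, PowerSeries.coeff_smul]
    simp only [θ, coeff_eulerDerivation]
    rcases n with _ | n
    · simp
    · rw [PowerSeries.coeff_succ_X_mul, hW, PowerSeries.coeff_mk, PowerSeries.coeff_mk,
        cliffordCoeff_eq_mul μ n, ← cliffordCoeff_succ, smul_eq_mul]
      push_cast
      ring
  have h1 : θ (W ^ 2) = 2 * (W * M) := by
    rw [sq, Derivation.leibniz, smul_eq_mul, ← hM]; ring
  have h2 : θ (W * M) = M ^ 2 + PowerSeries.X * W ^ 2 - μ • (W * M) := by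
    rw [Derivation.leibniz, hθM, ← hM]
    simp only [smul_eq_mul, mul_sub, mul_smul_comm]
    ring
  have h3 : θ (M ^ 2) = 2 * (PowerSeries.X * (W * M)) - (2 * μ) • M ^ 2 := by
    rw [sq, Derivation.leibniz, hθM]
    simp only [smul_eq_mul, mul_sub, mul_smul_comm, mul_smul, two_smul]
    ring
  have e1 := fun n => congrArg (PowerSeries.coeff n) h1
  have e2 := fun n => congrArg (PowerSeries.coeff n) h2
  have e3 := fun n => congrArg (PowerSeries.coeff n) h3
  simp only [θ, coeff_eulerDerivation, two_mul (_ : PowerSeries ℂ), map_add, map_sub,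
    PowerSeries.coeff_smul, smul_eq_mul] at e1 e2 e3
  have a1 := e1 (n + 1)
  have a2 := e2 (n + 1)
  have a3 := e3 (n + 1)
  have a4 := e1 n
  rw [PowerSeries.coeff_succ_X_mul] at a2 a3
  push_cast at *
  linear_combination ((n + 2 * μ + 1) * (n + μ + 1)) * a1 + 2 * (n + 2 * μ + 1) * a2 + 2 * a3 -
    2 * a4

lemma coeff_exp_mul_clifford_succ (μ : ℂ) {E C : PowerSeries ℂ}
    (hE : eulerDerivation E = (-2 : ℂ) • (PowerSeries.X * E))
    (hC : eulerDerivation (eulerDerivation C) =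
      (4 : ℂ) • (PowerSeries.X * (PowerSeries.X * C)) - (2 * μ) • eulerDerivation C) (n : ℕ) :
    ((n : ℂ) + 1) * (n + 2 * μ + 1) * PowerSeries.coeff (n + 1) (E * C) =
      -(2 * (2 * n + 2 * μ + 1)) * PowerSeries.coeff n (E * C) := by
  set θ := eulerDerivation
  have h1 : θ (E * C) = E * θ C - (2 : ℂ) • (PowerSeries.X * (E * C)) := by
    rw [Derivation.leibniz, hE]
    simp only [smul_eq_mul, mul_smul_comm, neg_smul, mul_neg]
    ring_nf
  have h2 : θ (E * θ C) = (4 : ℂ) • (PowerSeries.X * (PowerSeries.X * (E * C)))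
      - (2 * μ) • (E * θ C) - (2 : ℂ) • (PowerSeries.X * (E * θ C)) := by
    rw [Derivation.leibniz, hE, hC]
    simp only [smul_eq_mul, mul_smul_comm, neg_smul, mul_neg, mul_sub]
    ring_nf
  have e1 := fun n => congrArg (PowerSeries.coeff n) h1
  have e2 := fun n => congrArg (PowerSeries.coeff n) h2
  simp only [θ, coeff_eulerDerivation, map_sub, PowerSeries.coeff_smul, smul_eq_mul] at e1 e2
  have a1 := e1 (n + 1)
  have a2 := e2 (n + 1)
  have a3 := e1 n
  rw [PowerSeries.coeff_succ_X_mul] at a1 a2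
  rw [PowerSeries.coeff_succ_X_mul] at a2
  push_cast at *
  linear_combination (n + 2 * μ + 1) * a1 + a2 + 2 * a3

lemma coeff_clifford_sq_mul_Gamma {μ : ℂ} (h1 : ∀ n : ℕ, (n : ℂ) + 2 * μ + 1 ≠ 0)
    (h2 : ∀ n : ℕ, (n : ℂ) + μ + 1 ≠ 0) (n : ℕ) :
    (-1) ^ n * PowerSeries.coeff n (PowerSeries.mk (cliffordCoeff μ) ^ 2) *
        Complex.Gamma (n + μ + 1) =
      PowerSeries.coeff n (PowerSeries.rescale (-2) (PowerSeries.exp ℂ) *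
        PowerSeries.mk fun k => if Even k then cliffordCoeff μ (k / 2) else 0) := by
  have hE : eulerDerivation (PowerSeries.rescale (-2 : ℂ) (PowerSeries.exp ℂ)) =
      (-2 : ℂ) • (PowerSeries.X * PowerSeries.rescale (-2) (PowerSeries.exp ℂ)) := by
    ext n
    rw [coeff_eulerDerivation, PowerSeries.coeff_smul]
    rcases n with _ | n
    · simp
    · rw [PowerSeries.coeff_succ_X_mul, PowerSeries.coeff_rescale, PowerSeries.coeff_rescale,
        PowerSeries.coeff_exp, PowerSeries.coeff_exp, Nat.factorial_succ]
      have : (n.factorial : ℂ) ≠ 0 := by exact_mod_cast n.factorial_ne_zero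
      have : (n : ℂ) + 1 ≠ 0 := by exact_mod_cast n.succ_ne_zero
      simp only [one_div, map_inv₀, map_natCast, smul_eq_mul]
      push_cast
      field_simp
      ring
  have hC : eulerDerivation (eulerDerivation
      (PowerSeries.mk fun k => if Even k then cliffordCoeff μ (k / 2) else 0)) =
      (4 : ℂ) • (PowerSeries.X * (PowerSeries.X *
        PowerSeries.mk fun k => if Even k then cliffordCoeff μ (k / 2) else 0)) -
      (2 * μ) • eulerDerivation
        (PowerSeries.mk fun k => if Even k then cliffordCoeff μ (k / 2) else 0) := by
    ext n
    rw [map_sub, PowerSeries.coeff_smul, PowerSeries.coeff_smul, coeff_eulerDerivation,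
      coeff_eulerDerivation]
    rcases n with _ | _ | n
    · simp
    · simp
    · rw [PowerSeries.coeff_succ_X_mul, PowerSeries.coeff_succ_X_mul, PowerSeries.coeff_mk,
        PowerSeries.coeff_mk]
      by_cases hn : Even n
      · obtain ⟨j, rfl⟩ := hn
        rw [if_pos (by use j + 1; ring), if_pos ⟨j, rfl⟩, show (j + j + 1 + 1) / 2 = j + 1 by omega,
          show (j + j) / 2 = j by omega, cliffordCoeff_eq_mul μ j, ← cliffordCoeff_succ]
        simp only [smul_eq_mul]
        push_cast
        ring
      · rw [if_neg (by rwa [add_assoc, Nat.even_add, iff_true_right (by decide)]), if_neg hn]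
        simp
  induction n with
  | zero =>
    have h0 : Complex.Gamma (μ + 1) ≠ 0 := by
      refine Complex.Gamma_ne_zero fun m hm => h2 m ?_
      rw [add_assoc, hm]; ring
    simp only [sq, PowerSeries.coeff_mul, Finset.Nat.antidiagonal_zero, Finset.sum_singleton,
      PowerSeries.coeff_mk, PowerSeries.coeff_rescale, PowerSeries.coeff_exp]
    simp [cliffordCoeff, h0]
  | succ n ih =>
    have hn : (n : ℂ) + 1 ≠ 0 := by exact_mod_cast n.succ_ne_zero
    refine mul_left_cancel₀ (mul_ne_zero hn (h1 n)) ?_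
    rw [coeff_exp_mul_clifford_succ μ hE hC, ← ih, pow_succ]
    have h3 := coeff_clifford_sq_succ μ n
    push_cast
    rw [show (n : ℂ) + 1 + μ + 1 = n + μ + 1 + 1 by ring, Complex.Gamma_add_one _ (h2 n)]
    linear_combination (-1) ^ n * (-1) * Complex.Gamma (n + μ + 1) * h3

lemma integrableOn_cpow_mul_pow_mul_exp (τ : ℝ) (k : ℕ) {r : ℝ} (hr : 0 < r) :
    IntegrableOn (fun p : ℝ => (p : ℂ) ^ (Complex.I * τ) * (Real.exp (-(r * p)) : ℝ) * (p : ℂ) ^ k)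
      (Ioi 0) ∧
    ∫ p in Ioi (0 : ℝ), ‖(p : ℂ) ^ (Complex.I * τ) * (Real.exp (-(r * p)) : ℝ) * (p : ℂ) ^ k‖ =
      k.factorial / r ^ (k + 1) ∧
    ∫ p in Ioi (0 : ℝ), (p : ℂ) ^ (Complex.I * τ) * (Real.exp (-(r * p)) : ℝ) * (p : ℂ) ^ k =
      (r : ℂ) ^ (-(Complex.I * τ)) / r ^ (k + 1) * Complex.Gamma (k + Complex.I * τ + 1) := by
  have hnorm : ∀ p ∈ Ioi (0 : ℝ),
      ‖(p : ℂ) ^ (Complex.I * τ) * (Real.exp (-(r * p)) : ℝ) * (p : ℂ) ^ k‖ =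
        p ^ ((k + 1 : ℝ) - 1) * Real.exp (-(r * p)) := by
    intro p hp
    rw [norm_mul, norm_mul, norm_pow, Complex.norm_cpow_eq_rpow_re_of_pos hp, Complex.norm_real,
      Complex.norm_real, Real.norm_eq_abs, Real.abs_exp, Real.norm_of_nonneg (le_of_lt hp),
      add_sub_cancel_right, Real.rpow_natCast]
    simp [mul_comm]
  have hint : ∫ p in Ioi (0 : ℝ), p ^ ((k + 1 : ℝ) - 1) * Real.exp (-(r * p)) =
      k.factorial / r ^ (k + 1) := by
    rw [Real.integral_rpow_mul_exp_neg_mul_Ioi (by positivity) hr, Real.Gamma_nat_eq_factorial,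
      one_div, Real.inv_rpow hr.le, ← Nat.cast_succ, Real.rpow_natCast, Nat.succ_eq_add_one,
        pow_succ]
    ring
  have hmeas : AEStronglyMeasurable
      (fun p : ℝ => (p : ℂ) ^ (Complex.I * τ) * (Real.exp (-(r * p)) : ℝ) * (p : ℂ) ^ k)
      (volume.restrict (Ioi 0)) := by
    refine Measurable.aestronglyMeasurable ?_
    fun_prop
  refine ⟨?_, ?_, ?_⟩
  · have h : IntegrableOn (fun p : ℝ => p ^ ((k + 1 : ℝ) - 1) * Real.exp (-(r * p))) (Ioi 0) := by
      refine Integrable.of_integral_ne_zero ?_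
      rw [hint]; positivity
    refine h.mono' hmeas ?_
    filter_upwards [ae_restrict_mem measurableSet_Ioi] with p hp
    exact (hnorm p hp).le
  · rw [← hint]
    exact setIntegral_congr_fun measurableSet_Ioi hnorm
  · have h := Complex.integral_cpow_mul_exp_neg_mul_Ioi (a := k + Complex.I * τ + 1) (r := r)
      (by simp; positivity) (by simpa using hr)
    have h2 : ((1 / r : ℂ)) ^ ((k : ℂ) + Complex.I * τ + 1) =
        (r : ℂ) ^ (-(Complex.I * τ)) / r ^ (k + 1) := by
      have hr0 : (r : ℂ) ≠ 0 := by exact_mod_cast hr.ne'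
      have harg : (r : ℂ).arg ≠ π := by
        rw [Complex.arg_ofReal_of_nonneg hr.le]; exact Real.pi_ne_zero.symm
      rw [one_div, Complex.inv_cpow _ _ harg, show (k : ℂ) + Complex.I * τ + 1 =
        Complex.I * τ + ((k + 1 : ℕ) : ℂ) by push_cast; ring, Complex.cpow_add _ _ hr0, mul_inv,
        Complex.cpow_natCast, ← Complex.cpow_neg, div_eq_mul_inv]
    rw [← h2, ← h]
    refine setIntegral_congr_fun measurableSet_Ioi fun p hp => ?_
    have hp0 : (p : ℂ) ≠ 0 := by exact_mod_cast (ne_of_gt hp)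
    rw [add_sub_cancel_right, Complex.cpow_add _ _ hp0, Complex.cpow_natCast]
    push_cast
    rw [neg_mul_eq_neg_mul]
    ring

lemma hasSum_laplace {a : ℕ → ℂ} {e : ℕ → ℕ} (τ : ℝ) {r : ℝ} (hr : 0 < r)
    (h : Summable fun n => ‖a n‖ * ((e n).factorial / r ^ (e n + 1))) :
    HasSum (fun n => a n * ((r : ℂ) ^ (-(Complex.I * τ)) / r ^ (e n + 1) *
        Complex.Gamma (e n + Complex.I * τ + 1)))
      (∫ p in Ioi (0 : ℝ), (p : ℂ) ^ (Complex.I * τ) * (Real.exp (-(r * p)) : ℝ) *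
        ∑' n, a n * (p : ℂ) ^ (e n)) := by
  have H := hasSum_integral_of_summable_integral_norm (μ := volume.restrict (Ioi (0 : ℝ)))
    (F := fun n (p : ℝ) => a n * ((p : ℂ) ^ (Complex.I * τ) * (Real.exp (-(r * p)) : ℝ) *
      (p : ℂ) ^ (e n)))
    (fun n => (integrableOn_cpow_mul_pow_mul_exp τ (e n) hr).1.const_mul _) ?_
  · simp only [integral_const_mul, (integrableOn_cpow_mul_pow_mul_exp τ _ hr).2.2] at H
    have hp : ∀ p : ℝ, (p : ℂ) ^ (Complex.I * τ) * (Real.exp (-(r * p)) : ℝ) *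
        ∑' n, a n * (p : ℂ) ^ (e n) = ∑' n, a n * ((p : ℂ) ^ (Complex.I * τ) *
          (Real.exp (-(r * p)) : ℝ) * (p : ℂ) ^ (e n)) := by
      intro p
      rw [← tsum_mul_left]
      congr 1 with n
      ring
    simp only [hp]
    exact H
  · simp only [norm_mul (a _), integral_const_mul, (integrableOn_cpow_mul_pow_mul_exp τ _ hr).2.1]
    exact h

lemma hasSum_coeff_mul_pow {A B : PowerSeries ℂ} {z : ℂ}
    (hA : Summable fun n => ‖PowerSeries.coeff n A * z ^ n‖)
    (hB : Summable fun n => ‖PowerSeries.coeff n B * z ^ n‖) :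
    HasSum (fun n => PowerSeries.coeff n (A * B) * z ^ n)
      ((∑' n, PowerSeries.coeff n A * z ^ n) * ∑' n, PowerSeries.coeff n B * z ^ n) := by
  rw [tsum_mul_tsum_eq_tsum_sum_antidiagonal_of_summable_norm hA hB]
  have h := (summable_norm_sum_mul_antidiagonal_of_summable_norm hA hB).of_norm.hasSum
  refine h.congr_fun ?_
  intro n
  rw [PowerSeries.coeff_mul, Finset.sum_mul]
  refine Finset.sum_congr rfl fun p hp => ?_
  rw [← Finset.HasAntidiagonal.mem_antidiagonal.1 hp, pow_add]
  ring

lemma norm_coeff_clifford_sq_le (τ : ℝ) (n : ℕ) :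
    ‖PowerSeries.coeff n (PowerSeries.mk (cliffordCoeff (Complex.I * τ)) ^ 2)‖ * n.factorial ≤
      Real.cosh (π * τ) * (8 ^ n / n.factorial) := by
  rw [sq, PowerSeries.coeff_mul]
  have hc := (Real.cosh_pos (π * τ)).le
  have hterm : ∀ p ∈ Finset.HasAntidiagonal.antidiagonal n,
      ‖PowerSeries.coeff p.1 (PowerSeries.mk (cliffordCoeff (Complex.I * τ))) *
        PowerSeries.coeff p.2 (PowerSeries.mk (cliffordCoeff (Complex.I * τ)))‖ ≤
      Real.cosh (π * τ) * (2 ^ n / n.factorial) ^ 2 := by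
    intro p hp
    rw [Finset.HasAntidiagonal.mem_antidiagonal] at hp
    rw [PowerSeries.coeff_mk, PowerSeries.coeff_mk, norm_mul]
    have hch : (n.factorial : ℝ) ≤ 2 ^ n * (p.1.factorial * p.2.factorial) := by
      rw [← hp, ← Nat.add_choose_mul_factorial_mul_factorial]
      push_cast
      rw [mul_assoc]
      gcongr
      exact_mod_cast Nat.choose_le_two_pow _ _
    calc _ ≤ √(Real.cosh (π * τ)) / (p.1.factorial : ℝ) ^ 2 *
          (√(Real.cosh (π * τ)) / (p.2.factorial : ℝ) ^ 2) := by
          gcongr <;> exact norm_cliffordCoeff_I_mul_le τ _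
      _ = Real.cosh (π * τ) * (1 / (p.1.factorial * p.2.factorial)) ^ 2 := by
          rw [div_mul_div_comm, Real.mul_self_sqrt hc]; field_simp
      _ ≤ _ := by
          gcongr ?_ * ?_ ^ 2
          rw [div_le_div_iff₀ (by positivity) (by positivity), one_mul]
          exact hch
  have hn : ((n : ℝ) + 1) ≤ 2 ^ n := by exact_mod_cast Nat.lt_two_pow_self
  calc _ ≤ (∑ p ∈ Finset.HasAntidiagonal.antidiagonal n,
        Real.cosh (π * τ) * (2 ^ n / n.factorial) ^ 2) *
        (n.factorial : ℝ) := by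
        gcongr
        exact norm_sum_le_of_le _ hterm
    _ = ((n : ℝ) + 1) * (Real.cosh (π * τ) * (4 ^ n / n.factorial)) := by
        rw [Finset.sum_const, Finset.Nat.card_antidiagonal, nsmul_eq_mul, div_pow, ← pow_mul,
          mul_comm n 2, pow_mul]
        push_cast
        field_simp
        norm_num
    _ ≤ 2 ^ n * (Real.cosh (π * τ) * (4 ^ n / n.factorial)) := by gcongr
    _ = _ := by
        rw [show (8 : ℝ) = 2 * 4 by norm_num, mul_pow]; ring

lemma hasSum_clifford_sq (μ z : ℂ) :
    HasSum (fun n => PowerSeries.coeff n (PowerSeries.mk (cliffordCoeff μ) ^ 2) * z ^ n)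
      (clifford μ z ^ 2) := by
  have h : Summable fun n => ‖PowerSeries.coeff n (PowerSeries.mk (cliffordCoeff μ)) * z ^ n‖ := by
    simpa using summable_norm_cliffordCoeff μ ‖z‖
  have h2 := hasSum_coeff_mul_pow h h
  simp only [← sq, PowerSeries.coeff_mk] at h2
  exact h2

lemma hasSum_exp_mul_clifford (μ z : ℂ) :
    HasSum (fun n => PowerSeries.coeff n (PowerSeries.rescale (-2) (PowerSeries.exp ℂ) *
        PowerSeries.mk fun k => if Even k then cliffordCoeff μ (k / 2) else 0) * z ^ n)
      (Complex.exp (-(2 * z)) * clifford μ (z ^ 2)) := by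
  have hinj : Function.Injective fun j : ℕ => 2 * j := fun a b h => by simpa using h
  have hzero : ∀ n ∉ Set.range fun j : ℕ => 2 * j,
      PowerSeries.coeff n (PowerSeries.mk fun k => if Even k then cliffordCoeff μ (k / 2) else 0)
        * z ^ n = 0 := by
    intro n hn
    rw [PowerSeries.coeff_mk, if_neg, zero_mul]
    rintro ⟨j, rfl⟩
    exact hn ⟨j, by simp only; ring⟩
  have hcomp : (fun n => PowerSeries.coeff n
      (PowerSeries.mk fun k => if Even k then cliffordCoeff μ (k / 2) else 0) * z ^ n) ∘
      (fun j : ℕ => 2 * j) = fun j => cliffordCoeff μ j * (z ^ 2) ^ j := by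
    ext j
    simp [pow_mul]
  have hC : HasSum (fun n => PowerSeries.coeff n
      (PowerSeries.mk fun k => if Even k then cliffordCoeff μ (k / 2) else 0) * z ^ n)
      (clifford μ (z ^ 2)) := by
    rw [← hinj.hasSum_iff hzero, hcomp]
    exact hasSum_clifford μ (z ^ 2)
  have hCn : Summable fun n => ‖PowerSeries.coeff n
      (PowerSeries.mk fun k => if Even k then cliffordCoeff μ (k / 2) else 0) * z ^ n‖ := by
    rw [← hinj.summable_iff]
    · refine (summable_norm_cliffordCoeff μ ‖z ^ 2‖).congr fun j => ?_
      rw [← norm_pow, ← norm_mul]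
      exact congrArg norm (congrFun hcomp j).symm
    · intro n hn
      rw [hzero n hn, norm_zero]
  have hcoef : ∀ n, PowerSeries.coeff n (PowerSeries.rescale (-2) (PowerSeries.exp ℂ)) * z ^ n =
      (-(2 * z)) ^ n / n.factorial := by
    intro n
    rw [PowerSeries.coeff_rescale, PowerSeries.coeff_exp, ← neg_mul, mul_pow]
    simp only [one_div, map_inv₀, map_natCast]
    ring
  have hE := NormedSpace.expSeries_div_hasSum_exp (𝔸 := ℂ) (-(2 * z))
  rw [← Complex.exp_eq_exp_ℂ] at hE
  have hEn : Summable fun n =>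
      ‖PowerSeries.coeff n (PowerSeries.rescale (-2) (PowerSeries.exp ℂ)) * z ^ n‖ := by
    simp only [hcoef]
    exact NormedSpace.norm_expSeries_div_summable (-(2 * z))
  have h := hasSum_coeff_mul_pow hEn hCn
  rw [hC.tsum_eq] at h
  simp only [hcoef] at h
  rwa [hE.tsum_eq] at h

/-- The Laplace transform of the squared Bessel function `J` is a modified Bessel function. -/
lemma integral_exp_mul_clifford_sq (τ : ℝ) {X : ℝ} (hX : 0 < X) :
    ∫ p in Ioi (0 : ℝ), ((Real.exp (-p) : ℝ) : ℂ) * (((p * X : ℝ) : ℂ) ^ (Complex.I * τ) *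
        clifford (Complex.I * τ) (-(p * X : ℝ)) ^ 2) =
      (Real.exp (-(2 * X)) : ℝ) *
        ((X : ℂ) ^ (Complex.I * τ) * clifford (Complex.I * τ) (X ^ 2)) := by
  set μ : ℂ := Complex.I * τ with hμ
  set W := PowerSeries.mk (cliffordCoeff μ) with hW
  have h1 : ∀ n : ℕ, (n : ℂ) + 2 * μ + 1 ≠ 0 := by
    intro n h
    have := congrArg Complex.re h
    simp [hμ] at this
    have : (0 : ℝ) ≤ n := by positivity
    linarith
  have h2 : ∀ n : ℕ, (n : ℂ) + μ + 1 ≠ 0 := by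
    intro n h
    have := congrArg Complex.re h
    simp [hμ] at this
    have : (0 : ℝ) ≤ n := by positivity
    linarith
  have hs : Summable fun n => ‖PowerSeries.coeff n (W ^ 2) * (-(X : ℂ)) ^ n‖ *
      (((id n : ℕ).factorial : ℝ) / 1 ^ (id n + 1)) := by
    refine Summable.of_nonneg_of_le (fun n => by positivity) (fun n => ?_)
      ((Real.summable_pow_div_factorial (8 * X)).mul_left (Real.cosh (π * τ)))
    rw [norm_mul, norm_pow, norm_neg, Complex.norm_real, Real.norm_of_nonneg hX.le, one_pow,
      div_one]
    calc _ = ‖PowerSeries.coeff n (W ^ 2)‖ * n.factorial * X ^ n := mul_right_comm _ _ _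
      _ ≤ Real.cosh (π * τ) * (8 ^ n / n.factorial) * X ^ n :=
          mul_le_mul_of_nonneg_right (norm_coeff_clifford_sq_le τ n) (by positivity)
      _ = _ := by rw [mul_pow]; ring
  have H := hasSum_laplace τ one_pos hs
  have hpt : ∀ p ∈ Ioi (0 : ℝ), ((Real.exp (-p) : ℝ) : ℂ) * (((p * X : ℝ) : ℂ) ^ μ *
      clifford μ (-(p * X : ℝ)) ^ 2) = (X : ℂ) ^ μ * ((p : ℂ) ^ μ * (Real.exp (-(1 * p)) : ℝ) *
        ∑' n, PowerSeries.coeff n (W ^ 2) * (-(X : ℂ)) ^ n * (p : ℂ) ^ (id n)) := by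
    intro p hp
    rw [Complex.ofReal_mul, Complex.mul_cpow_ofReal_nonneg (le_of_lt hp) hX.le,
      ← (hasSum_clifford_sq μ _).tsum_eq, one_mul]
    simp only [id, mul_assoc, ← mul_pow, neg_mul, mul_comm (X : ℂ) (p : ℂ)]
    ring
  rw [setIntegral_congr_fun measurableSet_Ioi hpt, integral_const_mul]
  simp only [id, Complex.ofReal_one, Complex.one_cpow, one_pow, div_one, one_mul] at H
  have hterm : ∀ n : ℕ, PowerSeries.coeff n (W ^ 2) * (-(X : ℂ)) ^ n *
      Complex.Gamma (n + Complex.I * τ + 1) = PowerSeries.coeff n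
      (PowerSeries.rescale (-2) (PowerSeries.exp ℂ) *
        PowerSeries.mk fun k => if Even k then cliffordCoeff μ (k / 2) else 0) * (X : ℂ) ^ n := by
    intro n
    rw [← coeff_clifford_sq_mul_Gamma h1 h2, neg_pow]
    ring
  simp only [hterm] at H
  simp only [id, one_mul]
  rw [H.unique (hasSum_exp_mul_clifford μ X)]
  push_cast
  ring

/-- The generalised central binomial coefficient `Γ(2k + μ + 1) / (k! Γ(k + μ + 1))`. -/
noncomputable def centralCoeff (μ : ℂ) (k : ℕ) : ℂ :=
  cliffordCoeff μ k * Complex.Gamma ((2 * k : ℕ) + μ + 1)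

lemma centralCoeff_zero {τ : ℝ} : centralCoeff (Complex.I * τ) 0 = 1 := by
  have : Complex.Gamma (Complex.I * τ + 1) ≠ 0 :=
    Complex.Gamma_ne_zero_of_re_pos (by simp)
  simp [centralCoeff, cliffordCoeff, this]

lemma centralCoeff_succ (τ : ℝ) (k : ℕ) :
    ((k : ℂ) + 1) * (k + 1 + Complex.I * τ) * centralCoeff (Complex.I * τ) (k + 1) =
      (2 * k + Complex.I * τ + 2) * (2 * k + Complex.I * τ + 1) *
        centralCoeff (Complex.I * τ) k := by
  have h1 : (2 * (k : ℂ) + Complex.I * τ + 1) ≠ 0 := by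
    intro h
    have := congrArg Complex.re h
    simp at this
    have : (0 : ℝ) ≤ k := by positivity
    linarith
  have h2 : (2 * (k : ℂ) + Complex.I * τ + 1 + 1) ≠ 0 := by
    intro h
    have := congrArg Complex.re h
    simp at this
    have : (0 : ℝ) ≤ k := by positivity
    linarith
  have h3 := cliffordCoeff_succ (Complex.I * τ) k
  have h4 := cliffordCoeff_eq_mul (Complex.I * τ) k
  rw [centralCoeff, centralCoeff]
  push_cast
  rw [show 2 * ((k : ℂ) + 1) + Complex.I * τ + 1 = 2 * k + Complex.I * τ + 1 + 1 + 1 by ring,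
    Complex.Gamma_add_one _ h2, Complex.Gamma_add_one _ h1, h4, ← h3]
  ring

lemma norm_Gamma_natCast_add_le (n : ℕ) (τ : ℝ) :
    ‖Complex.Gamma (n + Complex.I * τ + 1)‖ ≤ n.factorial := by
  obtain ⟨-, h2, h3⟩ := integrableOn_cpow_mul_pow_mul_exp τ n one_pos
  simp only [Complex.ofReal_one, Complex.one_cpow, one_pow, div_one, one_mul] at h2 h3
  rw [← h2, ← h3]
  exact norm_integral_le_integral_norm _

lemma norm_cliffordCoeff_mul_factorial_le (τ : ℝ) (k : ℕ) :
    ‖cliffordCoeff (Complex.I * τ) k‖ * (2 * k).factorial ≤ √(Real.cosh (π * τ)) * 4 ^ k := by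
  have h : ((2 * k).factorial : ℝ) ≤ 4 ^ k * (k.factorial : ℝ) ^ 2 := by
    have h1 := Nat.add_choose_mul_factorial_mul_factorial k k
    have h2 : (k + k).choose k ≤ 2 ^ (k + k) := Nat.choose_le_two_pow _ _
    rw [two_mul, ← h1, show (4 : ℝ) = 2 ^ 2 by norm_num, ← pow_mul, two_mul]
    push_cast
    rw [mul_assoc, sq]
    gcongr
    exact_mod_cast h2
  calc _ ≤ √(Real.cosh (π * τ)) / (k.factorial : ℝ) ^ 2 * (4 ^ k * (k.factorial : ℝ) ^ 2) := by
        gcongr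
        exact norm_cliffordCoeff_I_mul_le τ k
    _ = _ := by field_simp

lemma norm_centralCoeff_le (τ : ℝ) (k : ℕ) :
    ‖centralCoeff (Complex.I * τ) k‖ ≤ √(Real.cosh (π * τ)) * 4 ^ k := by
  rw [centralCoeff, norm_mul]
  exact (mul_le_mul_of_nonneg_left (norm_Gamma_natCast_add_le _ τ) (norm_nonneg _)).trans
    (norm_cliffordCoeff_mul_factorial_le τ k)

lemma summable_norm_centralCoeff (τ : ℝ) {r : ℝ} (hr0 : 0 ≤ r) (hr : r < 1 / 4) :
    Summable fun k => ‖centralCoeff (Complex.I * τ) k‖ * r ^ k := by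
  refine Summable.of_nonneg_of_le (fun n => by positivity) (fun n => ?_)
    ((summable_geometric_of_lt_one (r := 4 * r) (by positivity) (by linarith)).mul_left
      √(Real.cosh (π * τ)))
  rw [mul_pow, ← mul_assoc]
  gcongr
  exact norm_centralCoeff_le τ n

lemma centralCoeff_ode {τ : ℝ} (hτ : τ ≠ 0) :
    ∃ S T : ℂ → ℂ, (∀ z, ‖z‖ < 1 / 4 →
      HasSum (fun k => centralCoeff (Complex.I * τ) k * z ^ k) (S z)) ∧ S 0 = 1 ∧ T 0 = 1 ∧
      ∀ z, ‖z‖ < 1 / 4 → ∃ S' T' : ℂ, HasDerivAt S S' z ∧ HasDerivAt T T' z ∧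
        2 * z * T' + Complex.I * τ * T z = Complex.I * τ * S z ∧
        (1 - 4 * z) * (2 * z * S' + Complex.I * τ * S z) =
          Complex.I * τ * T z + 4 * z * S z := by
  set μ : ℂ := Complex.I * τ with hμ
  have hμ0 : μ ≠ 0 := mul_ne_zero Complex.I_ne_zero (by exact_mod_cast hτ)
  have hk0 : ∀ k : ℕ, 2 * (k : ℂ) + μ ≠ 0 := by
    intro k h
    have := congrArg Complex.im h
    simp [hμ] at this
    exact hτ this
  set c := centralCoeff μ with hc
  set d : ℕ → ℂ := fun k => μ / (2 * k + μ) * c k with hd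
  have hdc : ∀ k, ‖d k‖ ≤ ‖c k‖ := by
    intro k
    rw [hd, norm_mul, norm_div]
    refine mul_le_of_le_one_left (norm_nonneg _) (div_le_one_of_le₀ ?_ (norm_nonneg _))
    refine le_trans (le_of_eq ?_) (Complex.abs_im_le_norm _)
    simp [hμ]
  have hcs : ∀ r : ℝ, 0 ≤ r → r < 1 / 4 → Summable fun k => ‖c k‖ * r ^ k := fun r h0 h =>
    summable_norm_centralCoeff τ h0 h
  have hds : ∀ r : ℝ, 0 ≤ r → r < 1 / 4 → Summable fun k => ‖d k‖ * r ^ k := fun r h0 h =>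
    Summable.of_nonneg_of_le (fun n => by positivity)
      (fun n => mul_le_mul_of_nonneg_right (hdc n) (by positivity)) (hcs r h0 h)
  refine ⟨fun z => ∑' k, c k * z ^ k, fun z => ∑' k, d k * z ^ k, ?_, ?_, ?_, ?_⟩
  · intro z hz
    exact (summable_pow_of_forall_norm (hcs _ (norm_nonneg z) hz) le_rfl).hasSum
  · simp only
    rw [tsum_eq_single 0]
    · simp [hc, hμ, centralCoeff_zero]
    · intro k hk; simp [hk]
  · simp only
    rw [tsum_eq_single 0]
    · simp [hd, hc, hμ0]
      simp [hμ, centralCoeff_zero]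
    · intro k hk; simp [hk]
  intro z hz
  obtain ⟨r, hzr, hr⟩ := exists_between hz
  have hr0 := (norm_nonneg z).trans hzr.le
  obtain ⟨hS, hS1, -⟩ := hasDerivAt_tsum_pow (hcs r hr0 hr) hzr
  obtain ⟨hT, hT1, -⟩ := hasDerivAt_tsum_pow (hds r hr0 hr) hzr
  have hS0 := (summable_pow_of_forall_norm (hcs r hr0 hr) hzr.le).hasSum
  have hT0 := (summable_pow_of_forall_norm (hds r hr0 hr) hzr.le).hasSum
  refine ⟨_, _, hS, hT, ?_, ?_⟩
  · refine HasSum.unique (f := fun k => μ * (c k * z ^ k)) ?_ (hS0.mul_left μ)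
    have h := (hT1.mul_left 2).add (hT0.mul_left μ)
    rw [← mul_assoc] at h
    refine h.congr_fun ?_
    intro k
    simp only [hd]
    field_simp [hk0 k]
  · have h := ((hS1.mul_left 2).add (hS0.mul_left μ)).sub (hT0.mul_left μ)
    rw [← hasSum_nat_add_iff' 1] at h
    have h5 := (((hS1.mul_left 2).add (hS0.mul_left (1 + μ))).mul_left (4 * z))
    have h6 := HasSum.unique h (h5.congr_fun ?_)
    · simp only [Finset.range_one, Finset.sum_singleton, hd] at h6
      have h7 : μ / (2 * (0 : ℕ) + μ) = 1 := by simp [hμ0]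
      rw [h7] at h6
      simp only [Nat.cast_zero] at h6
      linear_combination h6
    · intro k
      simp only [hd]
      have h8 := centralCoeff_succ τ k
      have hk1 := hk0 (k + 1)
      rw [← hμ, ← hc] at h8
      push_cast at hk1 ⊢
      field_simp
      rw [pow_succ]
      linear_combination 4 * z ^ k * z * h8

lemma tanh_mul_tsum_centralCoeff {τ : ℝ} (hτ : τ ≠ 0) {u : ℝ} (hu : 0 < u) :
    HasSum (fun k => centralCoeff (Complex.I * τ) k * (((2 * Real.cosh u)⁻¹ ^ 2 : ℝ) : ℂ) ^ k)
      (((2 * Real.cosh u : ℝ) : ℂ) ^ (Complex.I * τ) * Complex.exp (-(Complex.I * τ * u)) /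
        (Real.sinh u / Real.cosh u : ℝ)) := by
  obtain ⟨S, T, hS, hS0, hT0, hode⟩ := centralCoeff_ode hτ
  set μ : ℂ := Complex.I * τ with hμ
  set Z : ℝ → ℝ := fun u => (2 * Real.cosh u)⁻¹ ^ 2 with hZ
  set th : ℝ → ℝ := fun u => Real.sinh u / Real.cosh u with hth
  set P : ℝ → ℂ := fun u => Complex.exp (-μ * (Real.log (2 * Real.cosh u) : ℝ)) with hP
  have hcosh : ∀ v : ℝ, 0 < Real.cosh v := Real.cosh_pos
  have hZlt : ∀ v : ℝ, 0 < v → ‖((Z v : ℝ) : ℂ)‖ < 1 / 4 := by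
    intro v hv
    rw [Complex.norm_real, Real.norm_of_nonneg (by positivity), hZ]
    have h1 := Real.one_lt_cosh.2 hv.ne'
    simp only [inv_pow]
    rw [inv_lt_comm₀ (by positivity) (by norm_num)]
    nlinarith
  have hZd : ∀ v : ℝ, HasDerivAt (fun v => ((Z v : ℝ) : ℂ)) (((-2 * th v * Z v : ℝ)) : ℂ) v := by
    intro v
    refine HasDerivAt.ofReal_comp ?_
    have := (((Real.hasDerivAt_cosh v).const_mul 2).inv (by positivity)).pow 2
    refine this.congr_deriv ?_
    simp only [hZ, hth]
    have := (hcosh v).ne'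
    simp
    field_simp
  have hPd : ∀ v : ℝ, HasDerivAt P (-μ * th v * P v) v := by
    intro v
    have h1 := ((Real.hasDerivAt_cosh v).const_mul 2).log (by positivity)
    have h2 := (h1.ofReal_comp.const_mul (-μ)).cexp
    refine h2.congr_deriv ?_
    simp only [hP, hth]
    rw [mul_div_mul_left _ _ two_ne_zero]
    ring
  have hthd : ∀ v : ℝ, HasDerivAt (fun v => ((th v : ℝ) : ℂ)) ((4 * Z v : ℝ) : ℂ) v := by
    intro v
    refine HasDerivAt.ofReal_comp ?_
    refine ((Real.hasDerivAt_sinh v).div (Real.hasDerivAt_cosh v) (hcosh v).ne').congr_deriv ?_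
    simp only [hZ]
    have := (hcosh v).ne'
    field_simp
    linarith [Real.cosh_sq v]
  have hth2 : ∀ v : ℝ, ((th v : ℝ) : ℂ) ^ 2 = 1 - 4 * (Z v : ℝ) := by
    intro v
    norm_cast
    simp only [hZ, hth]
    have := (hcosh v).ne'
    field_simp
    linarith [Real.cosh_sq v]
  have hderiv : ∀ ε : ℂ, ε ^ 2 = 1 → ∀ v : ℝ, 0 < v → HasDerivAt
      (fun v : ℝ => Complex.exp (ε * μ * v) *
        (P v * (T (Z v : ℝ) + ε * (th v * S (Z v : ℝ))))) 0 v := by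
    intro ε hε v hv
    obtain ⟨S', T', hSd, hTd, h1, h2⟩ := hode _ (hZlt v hv)
    have hSc := hSd.comp_of_eq v (hZd v) rfl
    have hTc := hTd.comp_of_eq v (hZd v) rfl
    have he : HasDerivAt (fun v : ℝ => Complex.exp (ε * μ * v))
        (Complex.exp (ε * μ * v) * (ε * μ)) v := by
      simpa using ((hasDerivAt_id (v : ℂ)).const_mul (ε * μ)).cexp.comp_ofReal
    refine (he.mul ((hPd v).mul (hTc.add (((hthd v).mul hSc).const_mul ε)))).congr_deriv ?_
    have h3 := hth2 v
    simp only [Function.comp, Pi.add_apply, Pi.mul_apply]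
    push_cast
    linear_combination Complex.exp (ε * μ * v) * P v * (-(th v : ℂ) * h1 - ε * h2 -
      ε * (μ * S (Z v : ℝ) + 2 * (Z v : ℝ) * S') * h3 + μ * th v * S (Z v : ℝ) * hε)
  have hZ0 : Filter.Tendsto Z Filter.atTop (nhds 0) := by
    have : Filter.Tendsto (fun v => 2 * Real.cosh v) Filter.atTop Filter.atTop :=
      Filter.tendsto_atTop_mono (fun v => by rw [Real.cosh_eq]; linarith [Real.exp_pos (-v)])
        Real.tendsto_exp_atTop
    simpa [hZ] using this.inv_tendsto_atTop.pow 2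
  have hth1 : Filter.Tendsto th Filter.atTop (nhds 1) := by
    have h := ((hZ0.const_mul 4).const_sub 1).sqrt
    rw [mul_zero, sub_zero, Real.sqrt_one] at h
    refine h.congr' ?_
    filter_upwards [Filter.eventually_gt_atTop 0] with v hv
    have h1 : th v ^ 2 = 1 - 4 * Z v := by exact_mod_cast hth2 v
    rw [← h1, Real.sqrt_sq]
    exact div_nonneg (Real.sinh_nonneg_iff.2 hv.le) (hcosh v).le
  have hZc : Filter.Tendsto (fun v => ((Z v : ℝ) : ℂ)) Filter.atTop (nhds 0) := by
    exact_mod_cast (Complex.continuous_ofReal.tendsto 0).comp hZ0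
  have hthc : Filter.Tendsto (fun v => ((th v : ℝ) : ℂ)) Filter.atTop (nhds 1) := by
    exact_mod_cast (Complex.continuous_ofReal.tendsto 1).comp hth1
  obtain ⟨S', T', hSd, hTd, -, -⟩ := hode 0 (by simp)
  have hSl : Filter.Tendsto (fun v => S (Z v : ℝ)) Filter.atTop (nhds 1) :=
    hS0 ▸ hSd.continuousAt.tendsto.comp hZc
  have hTl : Filter.Tendsto (fun v => T (Z v : ℝ)) Filter.atTop (nhds 1) :=
    hT0 ▸ hTd.continuousAt.tendsto.comp hZc
  have hconst : ∀ ε : ℂ, ε ^ 2 = 1 → ∀ l, Filter.Tendsto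
      (fun v : ℝ => Complex.exp (ε * μ * v) * (P v * (T (Z v : ℝ) + ε * (th v * S (Z v : ℝ)))))
      Filter.atTop (nhds l) →
      Complex.exp (ε * μ * u) * (P u * (T (Z u : ℝ) + ε * (th u * S (Z u : ℝ)))) = l := by
    intro ε hε l hl
    refine tendsto_nhds_unique ((tendsto_const_nhds).congr' ?_) hl
    filter_upwards [Filter.eventually_gt_atTop 0] with v hv
    exact isOpen_Ioi.is_const_of_deriv_eq_zero (convex_Ioi (0 : ℝ)).isPreconnected
      (fun w hw => (hderiv ε hε w hw).differentiableAt.differentiableWithinAt)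
      (fun w hw => (hderiv ε hε w hw).deriv) hu hv
  have hlog : Filter.Tendsto (fun v : ℝ => v - Real.log (2 * Real.cosh v)) Filter.atTop
      (nhds 0) := by
    have h1 : Filter.Tendsto (fun v : ℝ => -Real.log (1 + Real.exp (-(2 * v)))) Filter.atTop
        (nhds 0) := by
      have h2 : Filter.Tendsto (fun v : ℝ => 1 + Real.exp (-(2 * v))) Filter.atTop (nhds 1) := by
        simpa using ((Real.tendsto_exp_neg_atTop_nhds_zero.comp
          (Filter.tendsto_id.const_mul_atTop (two_pos (α := ℝ)))).const_add 1)
      simpa using (h2.log one_ne_zero).neg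
    refine h1.congr fun v => ?_
    have h3 : 2 * Real.cosh v = Real.exp v * (1 + Real.exp (-(2 * v))) := by
      rw [Real.cosh_eq, mul_add, ← Real.exp_add]; ring_nf
    rw [h3, Real.log_mul (Real.exp_ne_zero _) (by positivity), Real.log_exp]
    ring
  have hplus := hconst 1 (one_pow 2) 2 (by
    have h1 : Filter.Tendsto
        (fun v : ℝ => Complex.exp (μ * ((v - Real.log (2 * Real.cosh v) : ℝ) : ℂ)))
        Filter.atTop (nhds 1) := by
      have := (Complex.continuous_exp.tendsto 0).comp
        ((((Complex.continuous_ofReal.tendsto 0).comp hlog).const_mul μ).trans (by simp))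
      rw [Complex.exp_zero] at this
      exact this
    have h2 := h1.mul (hTl.add (hthc.mul hSl))
    rw [one_mul, mul_one, one_add_one_eq_two] at h2
    refine h2.congr fun v => ?_
    rw [one_mul, one_mul, ← mul_assoc, hP, ← Complex.exp_add]
    congr 2
    push_cast
    ring)
  have hminus := hconst (-1) (by norm_num) 0 (by
    have h2 := hTl.add ((hthc.mul hSl).const_mul (-1))
    rw [mul_one, mul_one, add_neg_cancel] at h2
    rw [tendsto_zero_iff_norm_tendsto_zero] at h2 ⊢
    refine h2.congr fun v => ?_
    simp [hP, hμ, Complex.norm_exp])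
  have hthu : ((th u : ℝ) : ℂ) ≠ 0 := by
    exact_mod_cast (div_pos (Real.sinh_pos_iff.2 hu) (hcosh u)).ne'
  have hPu : (((2 * Real.cosh u : ℝ) : ℂ) ^ μ) * P u = 1 := by
    have h0 : 0 < 2 * Real.cosh u := by positivity
    rw [Complex.cpow_def_of_ne_zero (by exact_mod_cast h0.ne'), ← Complex.ofReal_log h0.le, hP,
      ← Complex.exp_add, ← Complex.exp_zero]
    congr 1
    ring
  convert hS _ (hZlt u hu) using 1
  rw [div_eq_iff hthu]
  have hm : P u * (T (Z u : ℝ) - th u * S (Z u : ℝ)) = 0 := by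
    have := (mul_eq_zero.1 hminus).resolve_left (Complex.exp_ne_zero _)
    rw [← this]; ring
  have hE : Complex.exp (-(μ * u)) * Complex.exp (1 * μ * u) = 1 := by
    rw [← Complex.exp_add, one_mul, neg_add_cancel, Complex.exp_zero]
  set A := ((2 * Real.cosh u : ℝ) : ℂ) ^ μ
  linear_combination -(1 / 2) * A * Complex.exp (-(μ * u)) * hplus +
    (1 / 2) * (T (Z u : ℝ) + th u * S (Z u : ℝ)) * (A * P u * hE + hPu) -
    (1 / 2) * (T (Z u : ℝ) - th u * S (Z u : ℝ)) * hPu + (1 / 2) * A * hm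

/-- The Laplace transform of `exp (-2X) * I_μ (2X)`, in the parametrisation that makes it
elementary. -/
lemma integral_exp_mul_clifford {τ : ℝ} (hτ : τ ≠ 0) {u : ℝ} (hu : 0 < u) {X : ℝ}
    (hX : X = 1 / (2 * (Real.cosh u - 1))) :
    ∫ p in Ioi (0 : ℝ), ((Real.exp (-p) : ℝ) : ℂ) * ((Real.exp (-(2 * (p * X))) : ℝ) *
        (((p * X : ℝ) : ℂ) ^ (Complex.I * τ) * clifford (Complex.I * τ) ((p * X : ℝ) ^ 2))) =
      Complex.exp (-(Complex.I * τ * u)) * ((Real.cosh u - 1) / Real.sinh u : ℝ) := by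
  set μ : ℂ := Complex.I * τ with hμ
  have hc1 : 0 < Real.cosh u - 1 := sub_pos.2 (Real.one_lt_cosh.2 hu.ne')
  have hch := Real.cosh_pos u
  have hX0 : 0 < X := by rw [hX]; positivity
  set r : ℝ := 1 + 2 * X with hr
  have hr0 : 0 < r := by positivity
  have hrX : X / r = (2 * Real.cosh u)⁻¹ := by
    rw [hr, hX]; field_simp; ring
  have hr1 : r * (Real.cosh u - 1) = Real.cosh u := by
    rw [hr, hX]; field_simp; ring
  have hs : Summable fun k => ‖cliffordCoeff μ k * (X : ℂ) ^ (2 * k)‖ *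
      (((2 * k : ℕ).factorial : ℝ) / r ^ (2 * k + 1)) := by
    have hq : 4 * (X / r) ^ 2 < 1 := by
      rw [hrX, inv_pow, ← div_eq_mul_inv, div_lt_one (by positivity)]
      nlinarith
    refine Summable.of_nonneg_of_le (fun k => by positivity) (fun k => ?_)
      ((summable_geometric_of_lt_one (by positivity) hq).mul_left (√(Real.cosh (π * τ)) / r))
    rw [norm_mul, norm_pow, Complex.norm_real, Real.norm_of_nonneg hX0.le]
    calc _ = ‖cliffordCoeff μ k‖ * (2 * k).factorial * ((X / r) ^ (2 * k) / r) := by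
          rw [div_pow, pow_succ]; field_simp
      _ ≤ √(Real.cosh (π * τ)) * 4 ^ k * ((X / r) ^ (2 * k) / r) :=
          mul_le_mul_of_nonneg_right (norm_cliffordCoeff_mul_factorial_le τ k) (by positivity)
      _ = _ := by rw [mul_pow, ← pow_mul]; ring
  have H := hasSum_laplace τ hr0 hs
  have hpt : ∀ p ∈ Ioi (0 : ℝ), ((Real.exp (-p) : ℝ) : ℂ) * ((Real.exp (-(2 * (p * X))) : ℝ) *
        (((p * X : ℝ) : ℂ) ^ μ * clifford μ ((p * X : ℝ) ^ 2))) =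
      (X : ℂ) ^ μ * ((p : ℂ) ^ μ * (Real.exp (-(r * p)) : ℝ) *
        ∑' k, cliffordCoeff μ k * (X : ℂ) ^ (2 * k) * (p : ℂ) ^ (2 * k)) := by
    intro p hp
    have h1 : Real.exp (-(r * p)) = Real.exp (-p) * Real.exp (-(2 * (p * X))) := by
      rw [← Real.exp_add, hr]; ring_nf
    have h2 : ∀ k, cliffordCoeff μ k * (X : ℂ) ^ (2 * k) * (p : ℂ) ^ (2 * k) =
        cliffordCoeff μ k * (((p * X : ℝ) : ℂ) ^ 2) ^ k := by
      intro k
      push_cast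
      rw [mul_assoc, ← mul_pow, pow_mul, mul_comm (X : ℂ)]
    simp only [h2]
    rw [h1, ← clifford, Complex.ofReal_mul p, Complex.mul_cpow_ofReal_nonneg (le_of_lt hp) hX0.le]
    push_cast
    ring
  rw [setIntegral_congr_fun measurableSet_Ioi hpt, integral_const_mul]
  have h1 := (tanh_mul_tsum_centralCoeff hτ hu).mul_left ((r : ℂ) ^ (-μ) / r)
  have hterm : ∀ k : ℕ, cliffordCoeff μ k * (X : ℂ) ^ (2 * k) * ((r : ℂ) ^ (-(Complex.I * τ)) /
      r ^ (2 * k + 1) * Complex.Gamma ((2 * k : ℕ) + Complex.I * τ + 1)) =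
      (r : ℂ) ^ (-μ) / r * (centralCoeff μ k * (((2 * Real.cosh u)⁻¹ ^ 2 : ℝ) : ℂ) ^ k) := by
    intro k
    have : (r : ℂ) ≠ 0 := by exact_mod_cast hr0.ne'
    rw [← hrX, centralCoeff, ← hμ, Complex.ofReal_pow, Complex.ofReal_div, ← pow_mul, div_pow,
      pow_succ]
    field_simp
  simp only [hterm] at H
  rw [H.unique h1]
  have hXr : (X : ℂ) ^ μ * ((r : ℂ) ^ (-μ) * ((2 * Real.cosh u : ℝ) : ℂ) ^ μ) = 1 := by
    have h2 : (r : ℂ) ^ μ = (X : ℂ) ^ μ * ((2 * Real.cosh u : ℝ) : ℂ) ^ μ := by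
      rw [← Complex.mul_cpow_ofReal_nonneg hX0.le (by positivity), ← Complex.ofReal_mul]
      congr 2
      rw [div_eq_iff hr0.ne'] at hrX
      rw [hrX]; field_simp
    have h3 : (r : ℂ) ^ μ * (r : ℂ) ^ (-μ) = 1 := by
      rw [← Complex.cpow_add _ _ (by exact_mod_cast hr0.ne'), add_neg_cancel, Complex.cpow_zero]
    rw [← h3, h2]; ring
  have hfac : (1 / r) / (Real.sinh u / Real.cosh u) = (Real.cosh u - 1) / Real.sinh u := by
    rw [div_div_eq_mul_div]
    congr 1
    field_simp
    linarith
  rw [← hfac, Complex.ofReal_div (1 / r), Complex.ofReal_div 1 r, Complex.ofReal_one]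
  linear_combination Complex.exp (-(μ * u)) * ((1 / r) / (Real.sinh u / Real.cosh u : ℝ)) * hXr

/-- The multiplicative Laplace average `x ↦ ∫₀^∞ exp (-p) f (p x) dp`. -/
noncomputable def laplaceAvg (f : ℝ → ℂ) (x : ℝ) : ℂ :=
  ∫ p in Ioi (0 : ℝ), ((Real.exp (-p) : ℝ) : ℂ) * f (p * x)

lemma stronglyMeasurable_laplaceAvg {f : ℝ → ℂ} (hf : StronglyMeasurable f) :
    StronglyMeasurable (laplaceAvg f) := by
  refine StronglyMeasurable.integral_prod_right (f := fun x p : ℝ =>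
    ((Real.exp (-p) : ℝ) : ℂ) * f (p * x)) ?_
  have := hf.measurable
  refine Measurable.stronglyMeasurable ?_
  unfold Function.uncurry
  fun_prop

lemma integrable_exp_mul_mellin {f : ℝ → ℂ} (hf : StronglyMeasurable f) {s : ℂ} (hs : s.re < 1)
    (hM : MellinConvergent f s) :
    Integrable (fun q : ℝ × ℝ => ((Real.exp (-q.1) : ℝ) : ℂ) *
      ((q.2 : ℂ) ^ (s - 1) * f (q.1 * q.2)))
      ((volume.restrict (Ioi 0)).prod (volume.restrict (Ioi 0))) := by
  have hfm := hf.measurable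
  have hmeas : Measurable (fun q : ℝ × ℝ => ((Real.exp (-q.1) : ℝ) : ℂ) *
      ((q.2 : ℂ) ^ (s - 1) * f (q.1 * q.2))) := by fun_prop
  rw [integrable_prod_iff hmeas.aestronglyMeasurable]
  constructor
  · filter_upwards [ae_restrict_mem measurableSet_Ioi] with p hp
    exact ((MellinConvergent.comp_mul_left hp).2 hM).const_mul _
  · set N : ℝ → ℝ := fun x => ‖(x : ℂ) ^ (s - 1) * f x‖ with hN
    have hnorm : ∀ p ∈ Ioi (0 : ℝ), ∫ x in Ioi (0 : ℝ), ‖((Real.exp (-p) : ℝ) : ℂ) *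
        ((x : ℂ) ^ (s - 1) * f (p * x))‖ =
        Real.exp (-p) * p ^ ((1 - s.re) - 1) * ∫ x in Ioi (0 : ℝ), N x := by
      intro p hp
      have h1 : ∀ x ∈ Ioi (0 : ℝ), ‖((Real.exp (-p) : ℝ) : ℂ) *
          ((x : ℂ) ^ (s - 1) * f (p * x))‖ = Real.exp (-p) * p ^ (1 - s.re) * N (p * x) := by
        intro x hx
        rw [hN]
        simp only [norm_mul]
        rw [Complex.norm_cpow_eq_rpow_re_of_pos hx, Complex.norm_real, Real.norm_eq_abs,
          Real.abs_exp, Complex.norm_cpow_eq_rpow_re_of_pos (mul_pos hp hx),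
          Real.mul_rpow (le_of_lt hp) (le_of_lt hx)]
        have h2 : p ^ (1 - s.re) * p ^ (s - 1).re = 1 := by
          rw [← Real.rpow_add hp]; simp
        linear_combination (-Real.exp (-p) * x ^ (s - 1).re * ‖f (p * x)‖) * h2
      rw [setIntegral_congr_fun measurableSet_Ioi h1, integral_const_mul,
        integral_comp_mul_left_Ioi (fun x => N x) 0 hp, mul_zero, smul_eq_mul,
        Real.rpow_sub_one (ne_of_gt hp)]
      ring
    have hI : IntegrableOn (fun p : ℝ => Real.exp (-p) * p ^ ((1 - s.re) - 1) *
        ∫ x in Ioi (0 : ℝ), N x) (Ioi 0) :=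
      (Real.GammaIntegral_convergent (by linarith)).mul_const _
    exact hI.congr_fun (fun p hp => (hnorm p hp).symm) measurableSet_Ioi

/-- The Laplace average multiplies the Mellin transform by `Γ(1 - s)`. -/
lemma mellin_laplaceAvg {f : ℝ → ℂ} (hf : StronglyMeasurable f) {s : ℂ} (hs : s.re < 1)
    (hM : MellinConvergent f s) :
    MellinConvergent (laplaceAvg f) s ∧
      mellin (laplaceAvg f) s = Complex.Gamma (1 - s) * mellin f s := by
  have hint := integrable_exp_mul_mellin hf hs hM
  have hpt : ∀ x : ℝ, (x : ℂ) ^ (s - 1) • laplaceAvg f x =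
      ∫ p in Ioi (0 : ℝ), ((Real.exp (-p) : ℝ) : ℂ) * ((x : ℂ) ^ (s - 1) * f (p * x)) := by
    intro x
    rw [laplaceAvg, smul_eq_mul, ← integral_const_mul]
    congr 1 with p
    ring
  constructor
  · rw [MellinConvergent]
    simp only [hpt]
    exact hint.integral_prod_right
  · rw [mellin]
    simp only [hpt]
    rw [← integral_integral_swap hint, Complex.Gamma_eq_integral (by simpa using hs),
      Complex.GammaIntegral, ← integral_mul_const]
    refine setIntegral_congr_fun measurableSet_Ioi fun p hp => ?_
    have h := mellin_comp_mul_left f s hp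
    rw [mellin] at h
    simp only [smul_eq_mul] at h
    rw [integral_const_mul, h, show 1 - s - 1 = -s by ring, mul_assoc]

lemma norm_Gamma_le {s : ℂ} (hs : 0 < s.re) : ‖Complex.Gamma s‖ ≤ Real.Gamma s.re := by
  rw [Complex.Gamma_eq_integral hs, Real.Gamma_eq_integral hs, Complex.GammaIntegral]
  refine (norm_integral_le_integral_norm _).trans (le_of_eq ?_)
  refine setIntegral_congr_fun measurableSet_Ioi fun x hx => ?_
  rw [norm_mul, Complex.norm_cpow_eq_rpow_re_of_pos hx, Complex.norm_real, Real.norm_eq_abs,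
    Real.abs_exp]
  simp

lemma integrable_Gamma_vertical {ν : ℝ} (hν : 0 < ν) :
    Integrable fun t : ℝ => Complex.Gamma (ν + t * Complex.I) := by
  have hre : ∀ (a t : ℝ), ((a : ℂ) + t * Complex.I).re = a := by simp
  have him : ∀ (a t : ℝ), ((a : ℂ) + t * Complex.I).im = t := by simp
  have hcont : Continuous fun t : ℝ => Complex.Gamma (ν + t * Complex.I) := by
    refine continuous_iff_continuousAt.2 fun t => ?_
    refine ContinuousAt.comp (f := fun t : ℝ => (ν : ℂ) + t * Complex.I) ?_ (by fun_prop)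
    refine (Complex.differentiableAt_Gamma _ fun m hm => ?_).continuousAt
    have := congrArg Complex.re hm
    rw [hre] at this
    simp at this
    have : (0 : ℝ) ≤ m := by positivity
    linarith
  set δ := min (ν ^ 2) 1 with hδ
  have hδ0 : 0 < δ := by positivity
  refine (integrable_inv_one_add_sq.const_mul (Real.Gamma (ν + 2) / δ)).mono'
    hcont.aestronglyMeasurable (Filter.Eventually.of_forall fun t => ?_)
  set s : ℂ := ν + t * Complex.I with hs
  have hs0 : s ≠ 0 := fun h => by
    have := congrArg Complex.re h
    rw [hs, hre] at this
    simp at this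
    linarith
  have hs1 : s + 1 ≠ 0 := fun h => by
    have := congrArg Complex.re h
    rw [Complex.add_re, hs, hre] at this
    simp at this
    linarith
  have h2 : Complex.Gamma (s + 1 + 1) = (s + 1) * (s * Complex.Gamma s) := by
    rw [Complex.Gamma_add_one _ hs1, Complex.Gamma_add_one _ hs0]
  have h3 : ‖Complex.Gamma (s + 1 + 1)‖ ≤ Real.Gamma (ν + 2) := by
    have h4 : (s + 1 + 1).re = ν + 2 := by
      simp only [Complex.add_re, hs, hre, Complex.one_re]
      ring
    rw [← h4]
    exact norm_Gamma_le (by rw [h4]; positivity)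
  rw [h2, norm_mul, norm_mul] at h3
  have hn1 : ‖s‖ ≤ ‖s + 1‖ := by
    rw [Complex.norm_eq_sqrt_sq_add_sq, Complex.norm_eq_sqrt_sq_add_sq]
    refine Real.sqrt_le_sqrt ?_
    simp only [hs, Complex.add_re _ 1, Complex.add_im _ 1, hre, him, Complex.one_re,
      Complex.one_im]
    nlinarith
  have hn2 : δ * (1 + t ^ 2) ≤ ‖s‖ ^ 2 := by
    rw [← Complex.normSq_eq_norm_sq, Complex.normSq_apply, hs, hre, him]
    have := min_le_left (ν ^ 2) 1
    have := min_le_right (ν ^ 2) 1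
    nlinarith [sq_nonneg t]
  have h5 : δ * (1 + t ^ 2) * ‖Complex.Gamma s‖ ≤ Real.Gamma (ν + 2) := by
    refine le_trans ?_ h3
    rw [← mul_assoc]
    refine mul_le_mul_of_nonneg_right (hn2.trans ?_) (norm_nonneg _)
    rw [sq]
    gcongr
  rw [div_mul_eq_mul_div, le_div_iff₀ hδ0, ← div_eq_mul_inv, le_div_iff₀ (by positivity)]
  linarith

lemma MellinConvergent.of_re_eq {f : ℝ → ℂ} (hf : StronglyMeasurable f) {s s' : ℂ}
    (h : s.re = s'.re) (hs : MellinConvergent f s) : MellinConvergent f s' := by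
  have hfm := hf.measurable
  refine Integrable.mono hs (Measurable.aestronglyMeasurable (by fun_prop)) ?_
  filter_upwards [ae_restrict_mem measurableSet_Ioi] with x hx
  rw [norm_smul, norm_smul, Complex.norm_cpow_eq_rpow_re_of_pos hx,
    Complex.norm_cpow_eq_rpow_re_of_pos hx]
  simp [h]

/-- Mellin inversion for the Gamma function. -/
lemma integral_Gamma_mul_cpow_neg {ν r : ℝ} (hν : 0 < ν) (hr : 0 < r) :
    ∫ t : ℝ, Complex.Gamma (ν + t * Complex.I) * (r : ℂ) ^ (-((ν : ℂ) + t * Complex.I)) =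
      2 * π * (Real.exp (-r) : ℝ) := by
  have hre : ∀ (a t : ℝ), ((a : ℂ) + t * Complex.I).re = a := by simp
  set E : ℝ → ℂ := fun x => ((Real.exp (-x) : ℝ) : ℂ) with hE
  have hmel : ∀ t : ℝ, mellin E (ν + t * Complex.I) = Complex.Gamma (ν + t * Complex.I) := by
    intro t
    rw [Complex.Gamma_eq_integral (by rwa [hre]), Complex.GammaIntegral_eq_mellin]
  have hconv : MellinConvergent E (ν : ℂ) := by
    have := Complex.GammaIntegral_convergent (s := (ν : ℂ)) (by simpa using hν)
    refine this.congr_fun (fun x _ => ?_) measurableSet_Ioi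
    simp only [hE, smul_eq_mul]
    ring
  have hver : VerticalIntegrable (mellin E) ν := by
    refine (integrable_Gamma_vertical hν).congr (Filter.Eventually.of_forall fun t => ?_)
    exact (hmel t).symm
  have h := mellinInv_mellin_eq ν E hr hconv hver (by rw [hE]; fun_prop)
  rw [mellinInv] at h
  simp only [hmel, smul_eq_mul] at h
  have hpi : (π : ℂ) ≠ 0 := by exact_mod_cast Real.pi_ne_zero
  rw [show (Real.exp (-r) : ℝ) = E r from rfl, ← h]
  rw [Complex.real_smul]
  push_cast
  rw [one_div, mul_inv_cancel_left₀ (by simp [hpi])]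
  simp only [mul_comm]

/-- A Mellin–Barnes integral with an extra factor `Γ(s)`. -/
lemma integral_Gamma_mul_mellin {h : ℝ → ℂ} (hh : StronglyMeasurable h) {ν y : ℝ} (hν : 0 < ν)
    (hy : 0 < y) (hM : MellinConvergent h ν) :
    ∫ t : ℝ, Complex.Gamma (ν + t * Complex.I) * mellin h (ν + t * Complex.I) *
        (y : ℂ) ^ (-((ν : ℂ) + t * Complex.I)) =
      2 * π * ∫ x in Ioi (0 : ℝ), ((x⁻¹ * Real.exp (-(y / x)) : ℝ) : ℂ) * h x := by
  have hre : ∀ (a t : ℝ), ((a : ℂ) + t * Complex.I).re = a := by simp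
  have hhm := hh.measurable
  set G : ℝ → ℝ → ℂ := fun t x => Complex.Gamma (ν + t * Complex.I) *
    ((x : ℂ) ^ ((ν : ℂ) + t * Complex.I - 1) * h x) * (y : ℂ) ^ (-((ν : ℂ) + t * Complex.I)) with hG
  have hint : Integrable (Function.uncurry G) (volume.prod (volume.restrict (Ioi 0))) := by
    have h1 := ((integrable_Gamma_vertical hν).mul_prod (ν := volume.restrict (Ioi 0)) hM).mul_const
      ((y : ℂ) ^ (-(ν : ℂ)))
    refine h1.mono ?_ ?_
    · have hΓ := (integrable_Gamma_vertical hν).aestronglyMeasurable.comp_fst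
        (ν := volume.restrict (Ioi (0 : ℝ)))
      refine (hΓ.mul (Measurable.aestronglyMeasurable ?_)).mul
        (Measurable.aestronglyMeasurable ?_)
      · fun_prop
      · fun_prop
    · have : ∀ᵐ q : ℝ × ℝ ∂(volume.prod (volume.restrict (Ioi 0))), q.2 ∈ Ioi (0 : ℝ) :=
        Measure.quasiMeasurePreserving_snd.ae (ae_restrict_mem measurableSet_Ioi)
      filter_upwards [this] with q hq
      simp only [hG, Function.uncurry, norm_mul, smul_eq_mul]
      rw [Complex.norm_cpow_eq_rpow_re_of_pos hq, Complex.norm_cpow_eq_rpow_re_of_pos hq,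
        Complex.norm_cpow_eq_rpow_re_of_pos hy, Complex.norm_cpow_eq_rpow_re_of_pos hy]
      simp
  have hL : ∀ t : ℝ, Complex.Gamma (ν + t * Complex.I) * mellin h (ν + t * Complex.I) *
        (y : ℂ) ^ (-((ν : ℂ) + t * Complex.I)) = ∫ x in Ioi (0 : ℝ), G t x := by
    intro t
    simp only [hG]
    rw [integral_mul_const, integral_const_mul, mellin]
    rfl
  simp only [hL]
  rw [integral_integral_swap hint, ← integral_const_mul]
  refine setIntegral_congr_fun measurableSet_Ioi fun x hx => ?_
  have hx0 : (x : ℂ) ≠ 0 := by exact_mod_cast (ne_of_gt hx)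
  have hR := integral_Gamma_mul_cpow_neg hν (div_pos hy hx)
  have hGx : ∀ t : ℝ, G t x = (Complex.Gamma (ν + t * Complex.I) *
      ((y / x : ℝ) : ℂ) ^ (-((ν : ℂ) + t * Complex.I))) * ((x : ℂ)⁻¹ * h x) := by
    intro t
    have h3 : (y : ℂ) ^ (-((ν : ℂ) + t * Complex.I)) =
        ((y / x : ℝ) : ℂ) ^ (-((ν : ℂ) + t * Complex.I)) *
          (x : ℂ) ^ (-((ν : ℂ) + t * Complex.I)) := by
      rw [← Complex.mul_cpow_ofReal_nonneg (div_pos hy hx).le (le_of_lt hx), ← Complex.ofReal_mul,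
        div_mul_cancel₀ _ (ne_of_gt hx)]
    have h4 : (x : ℂ) ^ ((ν : ℂ) + t * Complex.I - 1) *
        (x : ℂ) ^ (-((ν : ℂ) + t * Complex.I)) = (x : ℂ)⁻¹ := by
      rw [← Complex.cpow_add _ _ hx0, ← Complex.cpow_neg_one]
      congr 1
      ring
    simp only [hG]
    rw [h3, ← h4]
    ring
  simp only [hGx]
  rw [integral_mul_const, hR]
  push_cast
  ring

/-- The Mellin–Barnes integral with kernel `Γ(s) Γ(1 - s)²` as an iterated Laplace average. -/
lemma integral_Gamma_mul_Gamma_sq_mul_mellin {f : ℝ → ℂ} (hf : StronglyMeasurable f) {ν y : ℝ}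
    (hν : 0 < ν) (hν1 : ν < 1) (hy : 0 < y) (hM : MellinConvergent f ν) :
    ∫ t : ℝ, Complex.Gamma (ν + t * Complex.I) *
        Complex.Gamma (1 - ((ν : ℂ) + t * Complex.I)) ^ 2 * mellin f (ν + t * Complex.I) *
        (y : ℂ) ^ (-((ν : ℂ) + t * Complex.I)) =
      2 * π * ∫ x in Ioi (0 : ℝ), ((x⁻¹ * Real.exp (-(y / x)) : ℝ) : ℂ) *
        laplaceAvg (laplaceAvg f) x := by
  have hre : ∀ (a t : ℝ), ((a : ℂ) + t * Complex.I).re = a := by simp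
  have hf1 := stronglyMeasurable_laplaceAvg hf
  have hM1 := (mellin_laplaceAvg hf (by simpa using hν1) hM).1
  rw [← integral_Gamma_mul_mellin (stronglyMeasurable_laplaceAvg hf1) hν hy
    (mellin_laplaceAvg hf1 (by simpa using hν1) hM1).1]
  congr 1 with t
  have hs : ((ν : ℂ) + t * Complex.I).re < 1 := by rwa [hre]
  rw [(mellin_laplaceAvg hf1 hs (MellinConvergent.of_re_eq hf1 (by simp) hM1)).2,
    (mellin_laplaceAvg hf hs (MellinConvergent.of_re_eq hf (by simp) hM)).2]
  ring

/-- The kernel of the index transform `indexG`, as a function of a quarter of the argument. -/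
noncomputable def kernelJ (τ X : ℝ) : ℝ :=
  ((X : ℂ) ^ (Complex.I * τ) * clifford (Complex.I * τ) (-(X : ℂ)) ^ 2).re / Real.cosh (π * τ)

/-- The Laplace average of `kernelJ τ`. -/
noncomputable def kernelI (τ X : ℝ) : ℝ :=
  (((Real.exp (-(2 * X)) : ℝ) : ℂ) *
    ((X : ℂ) ^ (Complex.I * τ) * clifford (Complex.I * τ) ((X : ℂ) ^ 2))).re / Real.cosh (π * τ)

lemma measurable_kernelJ : Measurable (Function.uncurry kernelJ) := by
  have h : Measurable fun q : ℝ × ℝ => clifford (Complex.I * q.1) (-(q.2 : ℂ)) :=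
    measurable_clifford.comp (f := fun q : ℝ × ℝ => (Complex.I * (q.1 : ℂ), -(q.2 : ℂ)))
      (by fun_prop)
  unfold Function.uncurry kernelJ
  fun_prop

lemma measurable_kernelI : Measurable (Function.uncurry kernelI) := by
  have h : Measurable fun q : ℝ × ℝ => clifford (Complex.I * q.1) ((q.2 : ℂ) ^ 2) :=
    measurable_clifford.comp (f := fun q : ℝ × ℝ => (Complex.I * (q.1 : ℂ), (q.2 : ℂ) ^ 2))
      (by fun_prop)
  unfold Function.uncurry kernelI
  fun_prop

lemma norm_cpow_I_mul {X : ℝ} (hX : 0 < X) (τ : ℝ) : ‖(X : ℂ) ^ (Complex.I * τ)‖ = 1 := by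
  rw [Complex.norm_cpow_eq_rpow_re_of_pos hX]
  simp

lemma norm_cpow_mul_clifford_sq_le (τ : ℝ) {p X : ℝ} (hp : 0 < p) (hX : 0 < X) :
    ‖((p * X : ℝ) : ℂ) ^ (Complex.I * τ) * clifford (Complex.I * τ) (-((p * X : ℝ) : ℂ)) ^ 2‖ ≤
      Real.cosh (π * τ) * Real.exp (8 * X) * Real.exp (p / 2) := by
  rw [norm_mul, norm_cpow_I_mul (mul_pos hp hX), one_mul, norm_pow]
  have h := norm_clifford_I_mul_le τ (a := p / 4) (b := 4 * X) (z := -((p * X : ℝ) : ℂ))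
    (by positivity) (by positivity)
    (by rw [norm_neg, Complex.norm_real, Real.norm_of_nonneg (by positivity)]; linarith)
  refine (pow_le_pow_left₀ (norm_nonneg _) h 2).trans (le_of_eq ?_)
  rw [mul_pow, Real.sq_sqrt (Real.cosh_pos _).le, mul_pow, ← Real.exp_nat_mul, ← Real.exp_nat_mul]
  push_cast
  ring_nf

lemma abs_kernelJ_le (τ : ℝ) {p X : ℝ} (hp : 0 < p) (hX : 0 < X) :
    |kernelJ τ (p * X)| ≤ Real.exp (8 * X) * Real.exp (p / 2) := by
  have hc := Real.cosh_pos (π * τ)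
  rw [kernelJ, abs_div, abs_of_pos hc, div_le_iff₀ hc]
  refine (Complex.abs_re_le_norm _).trans ((norm_cpow_mul_clifford_sq_le τ hp hX).trans_eq ?_)
  ring

lemma norm_exp_mul_cpow_mul_clifford_le (τ : ℝ) {X : ℝ} (hX : 0 < X) :
    ‖((Real.exp (-(2 * X)) : ℝ) : ℂ) *
      ((X : ℂ) ^ (Complex.I * τ) * clifford (Complex.I * τ) ((X : ℂ) ^ 2))‖ ≤
      Real.cosh (π * τ) := by
  have h := norm_clifford_I_mul_le τ (a := X) (b := X) (z := (X : ℂ) ^ 2) hX.le hX.le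
    (by rw [norm_pow, Complex.norm_real, Real.norm_of_nonneg hX.le, sq])
  rw [norm_mul, norm_mul, norm_cpow_I_mul hX, one_mul, Complex.norm_real, Real.norm_eq_abs,
    Real.abs_exp]
  refine (mul_le_mul_of_nonneg_left h (Real.exp_pos _).le).trans ?_
  have h1 : Real.exp (-(2 * X)) * (√(Real.cosh (π * τ)) * (Real.exp X * Real.exp X)) =
      √(Real.cosh (π * τ)) := by
    rw [mul_left_comm, ← Real.exp_add, ← Real.exp_add, show -(2 * X) + (X + X) = 0 by ring,
      Real.exp_zero, mul_one]
  rw [h1]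
  exact Real.sqrt_le_iff.2 ⟨(Real.cosh_pos _).le, by nlinarith [Real.one_le_cosh (π * τ)]⟩

lemma abs_kernelI_le (τ : ℝ) {X : ℝ} (hX : 0 < X) : |kernelI τ X| ≤ 1 := by
  have hc := Real.cosh_pos (π * τ)
  rw [kernelI, abs_div, abs_of_pos hc, div_le_one hc]
  exact (Complex.abs_re_le_norm _).trans (norm_exp_mul_cpow_mul_clifford_le τ hX)

lemma integrableOn_exp_mul_of_norm_le {F : ℝ → ℂ} (hF : Measurable F) {C : ℝ}
    (h : ∀ p, 0 < p → ‖F p‖ ≤ C * Real.exp (p / 2)) :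
    IntegrableOn (fun p => ((Real.exp (-p) : ℝ) : ℂ) * F p) (Ioi 0) := by
  have hE : IntegrableOn (fun p : ℝ => C * Real.exp (-(1 / 2) * p)) (Ioi 0) :=
    (exp_neg_integrableOn_Ioi 0 (by norm_num : (0 : ℝ) < 1 / 2)).const_mul C
  refine Integrable.mono' hE (Measurable.aestronglyMeasurable (by fun_prop)) ?_
  filter_upwards [ae_restrict_mem measurableSet_Ioi] with p hp
  rw [norm_mul, Complex.norm_real, Real.norm_eq_abs, Real.abs_exp]
  refine (mul_le_mul_of_nonneg_left (h p hp) (Real.exp_pos _).le).trans_eq ?_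
  rw [mul_left_comm, ← Real.exp_add]
  ring_nf

lemma integral_exp_mul_re_div {F : ℝ → ℂ} (hF : Measurable F) {C : ℝ}
    (h : ∀ p, 0 < p → ‖F p‖ ≤ C * Real.exp (p / 2)) (c : ℝ) :
    ∫ p in Ioi (0 : ℝ), Real.exp (-p) * ((F p).re / c) =
      (∫ p in Ioi (0 : ℝ), ((Real.exp (-p) : ℝ) : ℂ) * F p).re / c := by
  have h1 := integral_re (𝕜 := ℂ) (integrableOn_exp_mul_of_norm_le hF h)
  rw [show (∫ p in Ioi (0 : ℝ), ((Real.exp (-p) : ℝ) : ℂ) * F p).re =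
    ∫ p in Ioi (0 : ℝ), (((Real.exp (-p) : ℝ) : ℂ) * F p).re from h1.symm, ← integral_div]
  simp only [Complex.re_ofReal_mul, mul_div_assoc]

lemma integral_exp_mul_kernelJ (τ : ℝ) {X : ℝ} (hX : 0 < X) :
    ∫ p in Ioi (0 : ℝ), Real.exp (-p) * kernelJ τ (p * X) = kernelI τ X := by
  have hm : Measurable fun p : ℝ => clifford (Complex.I * τ) (-((p * X : ℝ) : ℂ)) :=
    measurable_clifford.comp (f := fun p : ℝ => (Complex.I * (τ : ℂ), -((p * X : ℝ) : ℂ)))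
      (by fun_prop)
  simp only [kernelJ]
  rw [integral_exp_mul_re_div (by fun_prop)
    (fun p hp => norm_cpow_mul_clifford_sq_le τ hp hX), integral_exp_mul_clifford_sq τ hX, kernelI]

lemma integral_exp_mul_kernelI {τ u X : ℝ} (hτ : τ ≠ 0) (hu : 0 < u)
    (hX : X = 1 / (2 * (Real.cosh u - 1))) :
    ∫ p in Ioi (0 : ℝ), Real.exp (-p) * kernelI τ (p * X) =
      Real.cos (τ * u) * ((Real.cosh u - 1) / Real.sinh u) / Real.cosh (π * τ) := by
  have hX0 : 0 < X := by
    have := Real.one_lt_cosh.2 hu.ne'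
    rw [hX]
    exact one_div_pos.2 (by linarith)
  have hm : Measurable fun p : ℝ => clifford (Complex.I * τ) (((p * X : ℝ) : ℂ) ^ 2) :=
    measurable_clifford.comp (f := fun p : ℝ => (Complex.I * (τ : ℂ), ((p * X : ℝ) : ℂ) ^ 2))
      (by fun_prop)
  simp only [kernelI]
  rw [integral_exp_mul_re_div (C := Real.cosh (π * τ)) (by fun_prop) (fun p hp => ?_),
    integral_exp_mul_clifford hτ hu hX]
  · rw [Complex.re_mul_ofReal, Complex.exp_re]
    simp
  · refine (norm_exp_mul_cpow_mul_clifford_le τ (mul_pos hp hX0)).trans ?_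
    exact le_mul_of_one_le_right (Real.cosh_pos _).le (Real.one_le_exp (by positivity))

/-- The Laplace average of an index integral is taken under the integral sign. -/
lemma laplaceAvg_integral_mul {k : ℝ → ℝ → ℝ} (hk : Measurable (Function.uncurry k)) {g : ℝ → ℂ}
    (hg : Integrable g) {x C : ℝ} (h : ∀ τ p, 0 < p → |k τ (p * x)| ≤ C * Real.exp (p / 2)) :
    laplaceAvg (fun X => ∫ τ, (k τ X : ℂ) * g τ) x =
      ∫ τ, ((∫ p in Ioi (0 : ℝ), Real.exp (-p) * k τ (p * x) : ℝ) : ℂ) * g τ := by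
  have hE : IntegrableOn (fun p : ℝ => Real.exp (-(1 / 2) * p)) (Ioi 0) :=
    exp_neg_integrableOn_Ioi 0 (by norm_num)
  have hint : Integrable (Function.uncurry fun p τ : ℝ =>
      ((Real.exp (-p) : ℝ) : ℂ) * ((k τ (p * x) : ℂ) * g τ))
      ((volume.restrict (Ioi 0)).prod volume) := by
    refine Integrable.mono' ((hE.const_mul C).mul_prod hg.norm) ?_ ?_
    · have hk' : Measurable fun q : ℝ × ℝ => k q.2 (q.1 * x) :=
        hk.comp (f := fun q : ℝ × ℝ => (q.2, q.1 * x)) (by fun_prop)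
      have hg' := hg.aestronglyMeasurable.comp_snd (μ := volume.restrict (Ioi (0 : ℝ)))
      refine AEStronglyMeasurable.mul (Measurable.aestronglyMeasurable (by fun_prop)) ?_
      exact AEStronglyMeasurable.mul (Measurable.aestronglyMeasurable (by fun_prop)) hg'
    · filter_upwards [Measure.quasiMeasurePreserving_fst.ae
        (ae_restrict_mem (measurableSet_Ioi (a := (0 : ℝ))))] with q hq
      simp only [Function.uncurry, norm_mul, Complex.norm_real, Real.norm_eq_abs, Real.abs_exp]
      rw [← mul_assoc]
      refine mul_le_mul_of_nonneg_right ?_ (norm_nonneg _)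
      refine (mul_le_mul_of_nonneg_left (h q.2 q.1 hq) (Real.exp_pos _).le).trans_eq ?_
      rw [mul_left_comm, ← Real.exp_add]
      ring_nf
  simp only [laplaceAvg, ← integral_const_mul]
  rw [integral_integral_swap hint]
  congr 1 with τ
  rw [← integral_complex_ofReal, ← integral_mul_const]
  congr 1 with p
  push_cast
  ring

lemma indexG_eq {x : ℝ} (hx : 0 < x) (g : ℝ → ℂ) :
    indexG g x = (√π : ℂ) * ∫ τ, (kernelJ τ (x / 4) : ℂ) * g τ := by
  rw [indexG]
  congr 2 with τ
  have hs : (√x : ℂ) ≠ 0 := by exact_mod_cast (Real.sqrt_pos.2 hx).ne'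
  have h1 : ((√x : ℂ) / 2) ^ 2 = ((x / 4 : ℝ) : ℂ) := by
    rw [div_pow]
    norm_cast
    rw [Real.sq_sqrt hx.le]
    norm_num
  have h2 := cpow_sq_of_pos (half_pos (Real.sqrt_pos.2 hx)) (Complex.I * τ)
  push_cast at h2
  rw [besselJ_eq_clifford _ hs, h1, mul_pow, sq, ← h2, h1, kernelJ]
  push_cast
  ring

lemma stronglyMeasurable_integral_mul {k : ℝ → ℝ → ℝ} (hk : Measurable (Function.uncurry k))
    {g : ℝ → ℂ} (hg : AEStronglyMeasurable g) :
    StronglyMeasurable fun X => ∫ τ, (k τ X : ℂ) * g τ := by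
  have h : (fun X => ∫ τ, (k τ X : ℂ) * g τ) = fun X => ∫ τ, (k τ X : ℂ) * hg.mk g τ := by
    ext X
    refine integral_congr_ae ?_
    filter_upwards [hg.ae_eq_mk] with τ hτ
    rw [hτ]
  rw [h]
  refine StronglyMeasurable.integral_prod_right (f := fun X τ => (k τ X : ℂ) * hg.mk g τ) ?_
  have hk' : Measurable fun q : ℝ × ℝ => k q.2 q.1 :=
    hk.comp (f := fun q : ℝ × ℝ => (q.2, q.1)) (by fun_prop)
  have hm := hg.stronglyMeasurable_mk.measurable
  refine Measurable.stronglyMeasurable ?_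
  unfold Function.uncurry
  fun_prop

lemma laplaceAvg_const_mul_comp_div (c : ℂ) (f : ℝ → ℂ) (b x : ℝ) :
    laplaceAvg (fun x => c * f (x / b)) x = c * laplaceAvg f (x / b) := by
  simp only [laplaceAvg, ← integral_const_mul, mul_div_assoc]
  congr 1 with p
  ring

lemma laplaceAvg_laplaceAvg_kernelJ {g : ℝ → ℂ} (hg : Integrable g) {u X : ℝ} (hu : 0 < u)
    (hX : X = 1 / (2 * (Real.cosh u - 1))) :
    laplaceAvg (laplaceAvg fun X => ∫ τ, (kernelJ τ X : ℂ) * g τ) X =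
      ((Real.cosh u - 1) / Real.sinh u : ℝ) *
        ∫ τ, ((Real.cos (τ * u) / Real.cosh (π * τ) : ℝ) : ℂ) * g τ := by
  have hX0 : 0 < X := by
    have := Real.one_lt_cosh.2 hu.ne'
    rw [hX]
    exact one_div_pos.2 (by linarith)
  have h1 : ∀ Y, 0 < Y → laplaceAvg (fun X => ∫ τ, (kernelJ τ X : ℂ) * g τ) Y =
      ∫ τ, (kernelI τ Y : ℂ) * g τ := by
    intro Y hY
    rw [laplaceAvg_integral_mul measurable_kernelJ hg fun τ p hp => abs_kernelJ_le τ hp hY]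
    simp only [integral_exp_mul_kernelJ _ hY]
  have h2 : laplaceAvg (laplaceAvg fun X => ∫ τ, (kernelJ τ X : ℂ) * g τ) X =
      laplaceAvg (fun X => ∫ τ, (kernelI τ X : ℂ) * g τ) X := by
    rw [laplaceAvg, laplaceAvg]
    refine setIntegral_congr_fun measurableSet_Ioi fun p hp => ?_
    simp only [h1 _ (mul_pos hp hX0)]
  rw [h2, laplaceAvg_integral_mul measurable_kernelI hg (C := 1) fun τ p hp =>
    (abs_kernelI_le τ (mul_pos hp hX0)).trans (by
      rw [one_mul]; exact Real.one_le_exp (by positivity)), ← integral_const_mul]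
  refine integral_congr_ae ?_
  filter_upwards [compl_mem_ae_iff.2 (measure_singleton (0 : ℝ))] with τ hτ
  rw [integral_exp_mul_kernelI hτ hu hX]
  push_cast
  ring

lemma integral_Ioi_comp_two_div_cosh_sub_one (H : ℝ → ℂ) :
    ∫ x in Ioi (0 : ℝ), H x = ∫ u in Ioi (0 : ℝ),
      ((2 * Real.sinh u / (Real.cosh u - 1) ^ 2 : ℝ) : ℂ) * H (2 / (Real.cosh u - 1)) := by
  have hpos : ∀ u ∈ Ioi (0 : ℝ), 0 < Real.cosh u - 1 := fun u hu =>
    sub_pos.2 (Real.one_lt_cosh.2 (ne_of_gt hu))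
  have himg : (fun u => 2 / (Real.cosh u - 1)) '' Ioi (0 : ℝ) = Ioi 0 := by
    ext x
    constructor
    · rintro ⟨u, hu, rfl⟩
      exact div_pos two_pos (hpos u hu)
    · intro (hx : 0 < x)
      have h2 : 1 < 1 + 2 / x := by
        have := div_pos two_pos hx
        linarith
      refine ⟨Real.arcosh (1 + 2 / x), Real.arcosh_pos h2, ?_⟩
      simp only [Real.cosh_arcosh h2.le]
      field_simp
      ring
  have hderiv : ∀ u ∈ Ioi (0 : ℝ), HasDerivWithinAt (fun u => 2 / (Real.cosh u - 1))
      (-(2 * Real.sinh u / (Real.cosh u - 1) ^ 2)) (Ioi 0) u := by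
    intro u hu
    have h := (hasDerivAt_const u (2 : ℝ)).div ((Real.hasDerivAt_cosh u).sub_const 1)
      (hpos u hu).ne'
    exact (h.congr_deriv (by ring)).hasDerivWithinAt
  have hinj : InjOn (fun u => 2 / (Real.cosh u - 1)) (Ioi (0 : ℝ)) := by
    intro u hu v hv h
    have h1 := hpos u hu
    have h2 := hpos v hv
    simp only [div_eq_div_iff h1.ne' h2.ne'] at h
    exact Real.cosh_strictMonoOn.injOn (Ioi_subset_Ici_self hu) (Ioi_subset_Ici_self hv)
      (by linarith)
  rw [← himg, integral_image_eq_integral_abs_deriv_smul measurableSet_Ioi hderiv hinj, himg]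
  refine setIntegral_congr_fun measurableSet_Ioi fun u hu => ?_
  have h1 := hpos u hu
  have h2 := Real.sinh_pos_iff.2 hu
  simp only [abs_neg, Complex.real_smul]
  rw [abs_of_pos (by positivity)]

lemma integral_exp_mul_integral_cos {g : ℝ → ℂ} (hg : Integrable g) {y : ℝ} (hy : 0 < y) :
    ∫ u in Ioi (0 : ℝ), ((Real.exp (-(y * (Real.cosh u - 1) / 2)) : ℝ) : ℂ) *
        ∫ τ, ((Real.cos (τ * u) / Real.cosh (π * τ) : ℝ) : ℂ) * g τ =
      ∫ τ : ℝ, ((Real.exp (y / 2) : ℝ) : ℂ) * besselK (Complex.I * τ) ((y / 2 : ℝ) : ℂ) * g τ /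
        ((Real.cosh (π * τ) : ℝ) : ℂ) := by
  have hE : IntegrableOn (fun u : ℝ => Real.exp (-(y * (Real.cosh u - 1) / 2))) (Ioi 0) := by
    refine (((integrable_exp_neg_mul_cosh (half_pos hy)).const_mul
      (Real.exp (y / 2))).integrableOn).congr_fun (fun u _ => ?_) measurableSet_Ioi
    simp only [← Real.exp_add]
    congr 1
    ring
  have hint : Integrable (Function.uncurry fun u τ : ℝ =>
      ((Real.exp (-(y * (Real.cosh u - 1) / 2)) : ℝ) : ℂ) *
        (((Real.cos (τ * u) / Real.cosh (π * τ) : ℝ) : ℂ) * g τ))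
      ((volume.restrict (Ioi 0)).prod volume) := by
    refine Integrable.mono (hE.mul_prod hg.norm) ?_ (Filter.Eventually.of_forall fun q => ?_)
    · have hg' := hg.aestronglyMeasurable.comp_snd (μ := volume.restrict (Ioi (0 : ℝ)))
      refine AEStronglyMeasurable.mul (Measurable.aestronglyMeasurable (by fun_prop)) ?_
      exact AEStronglyMeasurable.mul (Measurable.aestronglyMeasurable (by fun_prop)) hg'
    · simp only [Function.uncurry, norm_mul, Complex.norm_real, norm_norm]
      refine mul_le_mul_of_nonneg_left ?_ (norm_nonneg _)
      refine mul_le_of_le_one_left (norm_nonneg _) ?_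
      rw [norm_div, Real.norm_eq_abs, Real.norm_eq_abs, abs_of_pos (Real.cosh_pos _),
        div_le_one (Real.cosh_pos _)]
      exact (Real.abs_cos_le_one _).trans (Real.one_le_cosh _)
  simp only [← integral_const_mul]
  rw [integral_integral_swap hint]
  refine integral_congr_ae ?_
  filter_upwards [compl_mem_ae_iff.2 (measure_singleton (0 : ℝ))] with τ hτ
  rw [besselK_I_mul_eq_integral hτ (half_pos hy), ← integral_const_mul, ← integral_mul_const,
    ← integral_div]
  congr 1 with u
  have h : Real.exp (-(y * (Real.cosh u - 1) / 2)) =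
      Real.exp (y / 2) * Real.exp (-(y / 2 * Real.cosh u)) := by
    rw [← Real.exp_add]
    congr 1
    ring
  rw [h]
  push_cast
  ring

/-- (Theorem 3, identity part) Let `g ∈ L_1(ℝ)` and `∫_0^∞ |(Gg)(x)| x^{ν−1} dx < ∞` for
some `0 < ν < 1/2`.  Then for all `y > 0`,
`(1/(2πi)) ∫_{ν−i∞}^{ν+i∞} Γ(s)Γ(1−s)² (Gg)*(s) y^{−s} ds
= √π ∫_{−∞}^∞ e^{y/2} K_{iτ}(y/2) g(τ)/cosh(πτ) dτ`
(the line integral is written as `(1/(2π)) ∫_{t ∈ ℝ}` after substituting `s = ν + it`). -/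
theorem indexG_mellin_identity (g : ℝ → ℂ) (ν : ℝ)
    (hg : MeasureTheory.Integrable g) (hν : 0 < ν) (hν' : ν < 1 / 2)
    (hG : MeasureTheory.IntegrableOn
      (fun x : ℝ => ‖indexG g x‖ * x ^ (ν - 1)) (Set.Ioi 0)) :
    ∀ y : ℝ, 0 < y →
      (1 / (2 * (π : ℂ))) * (∫ t : ℝ,
          Complex.Gamma ((ν : ℂ) + t * Complex.I) *
            Complex.Gamma (1 - ((ν : ℂ) + t * Complex.I)) ^ 2 *
            mellinT (indexG g) ((ν : ℂ) + t * Complex.I) *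
            (y : ℂ) ^ (-((ν : ℂ) + t * Complex.I))) =
        (Real.sqrt π : ℂ) * ∫ τ : ℝ,
          ((Real.exp (y / 2) : ℝ) : ℂ) * besselK (Complex.I * τ) ((y / 2 : ℝ) : ℂ) * g τ /
            ((Real.cosh (π * τ) : ℝ) : ℂ) := by
  intro y hy
  set f : ℝ → ℂ := fun X => ∫ τ, (kernelJ τ X : ℂ) * g τ
  set F : ℝ → ℂ := fun x => (√π : ℂ) * f (x / 4)
  have hfm :=
    (stronglyMeasurable_integral_mul measurable_kernelJ hg.aestronglyMeasurable).measurable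
  have hFm : StronglyMeasurable F := Measurable.stronglyMeasurable (by fun_prop)
  have hGF : ∀ x ∈ Ioi (0 : ℝ), indexG g x = F x := fun x hx => indexG_eq hx g
  have hM : MellinConvergent F ν := by
    refine Integrable.mono hG (Measurable.aestronglyMeasurable (by fun_prop)) ?_
    filter_upwards [ae_restrict_mem measurableSet_Ioi] with x hx
    rw [norm_smul, Complex.norm_cpow_eq_rpow_re_of_pos hx, hGF x hx,
      norm_mul _ (x ^ (ν - 1)), norm_norm, mul_comm,
      Real.norm_of_nonneg (Real.rpow_nonneg (le_of_lt hx) _)]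
    simp
  have hmel : ∀ s, mellinT (indexG g) s = mellin F s := fun s =>
    setIntegral_congr_fun measurableSet_Ioi fun x hx => by
      simp only [hGF x hx, smul_eq_mul, mul_comm]
  have hpi : (2 * π : ℂ) ≠ 0 := by
    simp [Real.pi_ne_zero]
  simp only [hmel]
  rw [integral_Gamma_mul_Gamma_sq_mul_mellin hFm hν (by linarith) hy hM, one_div,
    inv_mul_cancel_left₀ hpi, integral_Ioi_comp_two_div_cosh_sub_one,
    ← integral_exp_mul_integral_cos hg hy, ← integral_const_mul]
  refine setIntegral_congr_fun measurableSet_Ioi fun u hu => ?_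
  have hc : 0 < Real.cosh u - 1 := sub_pos.2 (Real.one_lt_cosh.2 (ne_of_gt hu))
  have hs : 0 < Real.sinh u := Real.sinh_pos_iff.2 hu
  have hLF : laplaceAvg (laplaceAvg F) (2 / (Real.cosh u - 1)) =
      (√π : ℂ) * laplaceAvg (laplaceAvg f) (2 / (Real.cosh u - 1) / 4) := by
    have : laplaceAvg F = fun x => (√π : ℂ) * laplaceAvg f (x / 4) :=
      funext fun x => laplaceAvg_const_mul_comp_div _ f 4 x
    rw [this, laplaceAvg_const_mul_comp_div]
  simp only [hLF]
  rw [laplaceAvg_laplaceAvg_kernelJ hg hu (by field_simp; ring)]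
  have hexp : y / (2 / (Real.cosh u - 1)) = y * (Real.cosh u - 1) / 2 := by field_simp
  have hone : 2 * Real.sinh u / (Real.cosh u - 1) ^ 2 * (2 / (Real.cosh u - 1))⁻¹ *
      ((Real.cosh u - 1) / Real.sinh u) = 1 := by field_simp
  rw [hexp]
  have hone' := congrArg (fun r : ℝ => (r : ℂ)) hone
  simp only [Complex.ofReal_mul _ ((Real.cosh u - 1) / Real.sinh u),
    Complex.ofReal_mul _ (2 / (Real.cosh u - 1))⁻¹, Complex.ofReal_one] at hone'
  rw [Complex.ofReal_mul (2 / (Real.cosh u - 1))⁻¹]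
  linear_combination ((Real.exp (-(y * (Real.cosh u - 1) / 2)) : ℝ) : ℂ) * (√π : ℂ) *
    (∫ τ, ((Real.cos (τ * u) / Real.cosh (π * τ) : ℝ) : ℂ) * g τ) * hone'
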